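/- Fix α ∈ (0,1) and positive integers n ≥ 2, k ≤ n, p, λ with m = pλ. There exists a universal constant C₁ > 0 such that if m ≥ p ≥ C₁·k·log⁴(n)/α², then for every row vector v ∈ ℝ^λ with v ≠ 0, taking V = I_p ⊗ v and V̂ = (1/(‖v‖₂√p))·V, and Φ ∈ ℝ^{m×n} drawn from the sign-randomized partial circulant ensemble, one has E sup_{x∈T_k} | ‖V̂Φx‖₂² − ‖x‖₂² | ≤ α. -/

import Mathlib

open scoped BigOperators Matrix
noncomputable section

/-- The sign `±1` associated with a boolean. -/
def rsign (b : Bool) : ℝ := if b then 1 else -1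

/-- Euclidean norm of a real vector. -/
def norm2 {n : ℕ} (x : Fin n → ℝ) : ℝ := Real.sqrt (∑ j, (x j) ^ 2)

/-- `T_k` (real version): unit-norm vectors with at most `k` nonzero entries. -/
def TkR (n k : ℕ) : Set (Fin n → ℝ) :=
  {x | norm2 x = 1 ∧ ∃ s : Finset (Fin n), s.card ≤ k ∧ ∀ t ∉ s, x t = 0}

/-- Block-diagonal matrix `I_p ⊗ v` with `p` copies of the row vector `v` on the diagonal. -/
def kronRow (p : ℕ) {lam : ℕ} (v : Fin lam → ℝ) : Matrix (Fin p) (Fin (p * lam)) ℝ :=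
  Matrix.of fun i j =>
    if (j : ℕ) / lam = (i : ℕ) then
      (if h2 : (j : ℕ) % lam < lam then v ⟨(j : ℕ) % lam, h2⟩ else 0)
    else 0

/-! ### Rademacher vectors and maximal inequalities -/

/-- The sign vector attached to `ξ`, as a point of Euclidean space. -/
def rad {ι : Type*} (ξ : ι → Bool) : EuclideanSpace ℝ ι :=
  WithLp.toLp 2 fun s => rsign (ξ s)

/-- The sign vector attached to `ξ`, restricted to the coordinates selected by `η`. -/
def radOn {ι : Type*} (η ξ : ι → Bool) : EuclideanSpace ℝ ι :=
  WithLp.toLp 2 fun s => if η s then rsign (ξ s) else 0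

lemma rsign_sq (b : Bool) : rsign b ^ 2 = 1 := by cases b <;> simp [rsign]

lemma rsign_mul_self (b : Bool) : rsign b * rsign b = 1 := by cases b <;> simp [rsign]

lemma abs_rsign (b : Bool) : |rsign b| = 1 := by cases b <;> simp [rsign]

section Rademacher

variable {ι : Type*}

/-- Swapping the coordinates outside `η` between two sign patterns. -/
def swapOff (η : ι → Bool) : (ι → Bool) × (ι → Bool) ≃ (ι → Bool) × (ι → Bool) where
  toFun q := (fun s => if η s then q.1 s else q.2 s, fun s => if η s then q.2 s else q.1 s)
  invFun q := (fun s => if η s then q.1 s else q.2 s, fun s => if η s then q.2 s else q.1 s)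
  left_inv q := by ext s <;> by_cases h : η s <;> simp [h]
  right_inv q := by ext s <;> by_cases h : η s <;> simp [h]

/-- Flipping the signs outside `η`. -/
def flipOff (η : ι → Bool) : (ι → Bool) ≃ (ι → Bool) where
  toFun ξ s := if η s then ξ s else !ξ s
  invFun ξ s := if η s then ξ s else !ξ s
  left_inv ξ := by ext s; by_cases h : η s <;> simp [h]
  right_inv ξ := by ext s; by_cases h : η s <;> simp [h]

lemma rad_add_rad_flipOff (η ξ : ι → Bool) :
    rad ξ + rad (flipOff η ξ) = (2 : ℝ) • radOn η ξ := by
  ext s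
  by_cases h : η s <;> cases h' : ξ s <;> simp [rad, radOn, flipOff, h, h', rsign] <;> norm_num

lemma rad_sub_rad_flipOff (η ξ : ι → Bool) :
    rad ξ - rad (flipOff η ξ) = (2 : ℝ) • radOn (fun s => !η s) ξ := by
  ext s
  by_cases h : η s <;> cases h' : ξ s <;> simp [rad, radOn, flipOff, h, h', rsign] <;> norm_num

/-- Exchanging the roles of the two arguments of `flipOff` up to a bijection. -/
def flipBy (ξ : ι → Bool) : (ι → Bool) ≃ (ι → Bool) where
  toFun η := flipOff η ξ
  invFun ζ s := ζ s == ξ s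
  left_inv η := by ext s; by_cases h : η s <;> cases h' : ξ s <;> simp [flipOff, h, h']
  right_inv ζ := by ext s; cases h : ζ s <;> cases h' : ξ s <;> simp [flipOff, h, h']

variable [Fintype ι]

lemma norm_radOn_le (η ξ : ι → Bool) : ‖radOn η ξ‖ ≤ √(Fintype.card ι) := by
  rw [EuclideanSpace.norm_eq]
  apply Real.sqrt_le_sqrt
  calc ∑ s, ‖radOn η ξ s‖ ^ 2 ≤ ∑ _s : ι, (1 : ℝ) := by
        refine Finset.sum_le_sum fun s _ => ?_
        by_cases h : η s <;> simp [radOn, h, rsign_sq]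
    _ = Fintype.card ι := by simp

variable [DecidableEq ι]

lemma expect_exp_inner_radOn_le (η : ι → Bool) (h : EuclideanSpace ℝ ι) :
    𝔼 ξ : ι → Bool, Real.exp (inner ℝ (radOn η ξ) h) ≤ Real.exp (‖h‖ ^ 2 / 2) := by
  set f : ι → Bool → ℝ := fun s b => Real.exp (h s * (if η s then rsign b else 0)) with hf
  have h1 : ∀ ξ : ι → Bool, Real.exp (inner ℝ (radOn η ξ) h) = ∏ s, f s (ξ s) := by
    intro ξ
    simp only [hf, ← Real.exp_sum]
    simp [PiLp.inner_apply, radOn]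
  have h2 : ∑ ξ : ι → Bool, ∏ s, f s (ξ s) = ∏ s, ∑ b, f s b := by
    rw [Finset.prod_univ_sum, Fintype.piFinset_univ]
  simp_rw [h1]
  rw [Fintype.expect_eq_sum_div_card, h2]
  have hc : (Fintype.card (ι → Bool) : ℝ) = ∏ _s : ι, (2 : ℝ) := by simp
  rw [hc, ← Finset.prod_div_distrib, EuclideanSpace.real_norm_sq_eq, Finset.sum_div, Real.exp_sum]
  refine Finset.prod_le_prod (fun s _ => by simp only [hf]; positivity) fun s _ => ?_
  by_cases hs : η s
  · refine le_trans (le_of_eq ?_) (Real.cosh_le_exp_half_sq (h s))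
    simp [hf, hs, rsign, Real.cosh_eq]
  · simp [hf, hs]
    positivity

/-- Maximal inequality for finitely many Rademacher sums, in terms of a dominating function. -/
lemma exists_radOn_max_bound (η : ι → Bool) (S : Finset (EuclideanSpace ℝ ι)) {b l : ℝ}
    (hb : 0 ≤ b) (hl : 1 ≤ l) (hS : ∀ h ∈ S, ‖h‖ ≤ b)
    (hcard : 2 * (S.card : ℝ) ≤ Real.exp (l ^ 2)) :
    ∃ M : (ι → Bool) → ℝ, (∀ ξ, ∀ h ∈ S, |inner ℝ (radOn η ξ) h| ≤ M ξ) ∧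
      𝔼 ξ, M ξ ≤ 3 * l * b := by
  rcases hb.eq_or_lt with rfl | hb
  · refine ⟨fun _ => 0, fun ξ h hh => ?_, by simp⟩
    have : h = 0 := norm_le_zero_iff.1 (hS h hh)
    simp [this]
  have hl0 : 0 < l := by linarith
  set t : ℝ := l / b with ht
  have ht0 : 0 < t := by positivity
  set a : ℝ := 3 / 2 * l * b with ha
  have key : ∀ y : ℝ, y ≤ a + Real.exp (-(t * a)) / t * Real.exp (t * y) := by
    intro y
    have h1 := Real.add_one_le_exp (t * (y - a))
    have h2 : Real.exp (-(t * a)) / t * Real.exp (t * y) = Real.exp (t * (y - a)) / t := by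
      rw [div_mul_eq_mul_div, ← Real.exp_add]; ring_nf
    rw [h2, ← sub_le_iff_le_add', le_div_iff₀ ht0]
    linarith
  refine ⟨fun ξ => a + Real.exp (-(t * a)) / t *
    ∑ h ∈ S, (Real.exp (inner ℝ (radOn η ξ) (t • h)) +
      Real.exp (inner ℝ (radOn η ξ) ((-t) • h))), fun ξ h hh => ?_, ?_⟩
  · have hsum : Real.exp (inner ℝ (radOn η ξ) (t • h)) +
        Real.exp (inner ℝ (radOn η ξ) ((-t) • h)) ≤
        ∑ h ∈ S, (Real.exp (inner ℝ (radOn η ξ) (t • h)) +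
          Real.exp (inner ℝ (radOn η ξ) ((-t) • h))) :=
      Finset.single_le_sum (f := fun h => Real.exp (inner ℝ (radOn η ξ) (t • h)) +
          Real.exp (inner ℝ (radOn η ξ) ((-t) • h))) (fun _ _ => by positivity) hh
    have hc : 0 ≤ Real.exp (-(t * a)) / t := by positivity
    have hm := mul_le_mul_of_nonneg_left hsum hc
    rw [mul_add] at hm
    have e1 := key (inner ℝ (radOn η ξ) h)
    have e2 := key (-inner ℝ (radOn η ξ) h)
    simp only [inner_smul_right] at hm ⊢
    have e3 : t * -inner ℝ (radOn η ξ) h = -t * inner ℝ (radOn η ξ) h := by ring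
    rw [e3] at e2
    have p1 : 0 ≤ Real.exp (-(t * a)) / t * Real.exp (t * inner ℝ (radOn η ξ) h) := by positivity
    have p2 : 0 ≤ Real.exp (-(t * a)) / t * Real.exp (-t * inner ℝ (radOn η ξ) h) := by positivity
    rw [abs_le]
    constructor <;> linarith
  · rw [Finset.expect_add_distrib, Fintype.expect_const, ← Finset.mul_expect,
      Finset.expect_sum_comm]
    have hterm : ∀ h ∈ S, 𝔼 ξ : ι → Bool, (Real.exp (inner ℝ (radOn η ξ) (t • h)) +
          Real.exp (inner ℝ (radOn η ξ) ((-t) • h))) ≤ 2 * Real.exp (l ^ 2 / 2) := by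
      intro h hh
      have hn : (t * ‖h‖) ^ 2 / 2 ≤ l ^ 2 / 2 := by
        have : t * ‖h‖ ≤ l := by
          calc t * ‖h‖ ≤ t * b := by gcongr; exact hS h hh
            _ = l := by rw [ht]; field_simp
        gcongr
      rw [Finset.expect_add_distrib]
      have e1 := expect_exp_inner_radOn_le η (t • h)
      have e2 := expect_exp_inner_radOn_le η ((-t) • h)
      have n1 : ‖t • h‖ = t * ‖h‖ := by rw [norm_smul, Real.norm_of_nonneg ht0.le]
      have n2 : ‖(-t) • h‖ = t * ‖h‖ := by rw [norm_smul, norm_neg, Real.norm_of_nonneg ht0.le]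
      rw [n1] at e1
      rw [n2] at e2
      have := Real.exp_le_exp.2 hn
      linarith
    have hsum : ∑ h ∈ S, 𝔼 ξ : ι → Bool, (Real.exp (inner ℝ (radOn η ξ) (t • h)) +
          Real.exp (inner ℝ (radOn η ξ) ((-t) • h))) ≤ Real.exp (t * a) := by
      calc _ ≤ ∑ _h ∈ S, 2 * Real.exp (l ^ 2 / 2) := Finset.sum_le_sum hterm
        _ = 2 * (S.card : ℝ) * Real.exp (l ^ 2 / 2) := by simp; ring
        _ ≤ Real.exp (l ^ 2) * Real.exp (l ^ 2 / 2) := by gcongr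
        _ = Real.exp (t * a) := by
          rw [← Real.exp_add]; congr 1; rw [ht, ha]; field_simp; ring
    calc a + Real.exp (-(t * a)) / t * _ ≤ a + Real.exp (-(t * a)) / t * Real.exp (t * a) := by
          gcongr
      _ = a + b / l := by
          rw [div_mul_eq_mul_div, ← Real.exp_add, neg_add_cancel, Real.exp_zero, ht]
          field_simp
      _ ≤ 3 * l * b := by
          have : b / l ≤ l * b := by
            rw [div_le_iff₀ hl0]; nlinarith [mul_le_mul hl hl (by norm_num) (by linarith)]
          rw [ha]; nlinarith

/-- The restrictions of a sign vector to complementary sets of coordinates are independent. -/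
lemma expect_radOn_compl (η : ι → Bool)
    (F : EuclideanSpace ℝ ι → EuclideanSpace ℝ ι → ℝ) :
    𝔼 ξ : ι → Bool, F (radOn η ξ) (radOn (fun s => !η s) ξ) =
      𝔼 ξ : ι → Bool, 𝔼 ξ' : ι → Bool, F (radOn η ξ) (radOn (fun s => !η s) ξ') := by
  rw [← Finset.expect_product' Finset.univ Finset.univ
    fun ξ ξ' : ι → Bool => F (radOn η ξ) (radOn (fun s => !η s) ξ'), Finset.univ_product_univ]
  have h : 𝔼 q : (ι → Bool) × (ι → Bool), F (radOn η q.1) (radOn (fun s => !η s) q.1) =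
      𝔼 ξ : ι → Bool, F (radOn η ξ) (radOn (fun s => !η s) ξ) := by
    rw [← Finset.univ_product_univ, Finset.expect_product]
    simp
  rw [← h]
  symm
  refine Fintype.expect_equiv (swapOff η) _ _ fun q => ?_
  have h1 : radOn η q.1 = radOn η (swapOff η q).1 := by
    ext s; by_cases h : η s <;> simp [radOn, swapOff, h]
  have h2 : radOn (fun s => !η s) q.2 = radOn (fun s => !η s) (swapOff η q).1 := by
    ext s; by_cases h : η s <;> simp [radOn, swapOff, h]
  rw [h1, h2]

end Rademacher

/-! ### Chaining for Rademacher chaos -/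

lemma abs_le_abs_zero_add_sum_range (D : ℕ → ℝ) (R : ℕ) :
    |D R| ≤ |D 0| + ∑ r ∈ Finset.range R, |D (r + 1) - D r| := by
  induction R with
  | zero => simp
  | succ R ih =>
    rw [Finset.sum_range_succ]
    have : D (R + 1) = D R + (D (R + 1) - D R) := by ring
    calc |D (R + 1)| ≤ |D R| + |D (R + 1) - D R| := by
          conv_lhs => rw [this]
          exact abs_add_le _ _
      _ ≤ _ := by linarith

section Chaos

variable {ι : Type*} {H X : Type*} [NormedAddCommGroup H] [InnerProductSpace ℝ H]

/-- The largest norm of the image of `w` under a family of operators. -/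
def supNorm (A : X → EuclideanSpace ℝ ι →L[ℝ] H) (w : EuclideanSpace ℝ ι) : ℝ :=
  ⨆ x, ‖A x w‖

variable {A : X → EuclideanSpace ℝ ι →L[ℝ] H} {δ l : ℝ}

lemma supNorm_nonneg (w : EuclideanSpace ℝ ι) : 0 ≤ supNorm A w :=
  Real.iSup_nonneg fun _ => norm_nonneg _

variable [Fintype ι]

/-- A sequence of finite nets for a bounded family of operators, with geometrically decreasing
mesh and controlled cardinality. -/
structure ChainingNets (A : X → EuclideanSpace ℝ ι →L[ℝ] H) (δ l : ℝ) where
  /-- the finite nets -/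
  net : ℕ → Finset X
  /-- the approximation of a point at a given scale -/
  proj : ℕ → X → X
  proj_mem : ∀ r x, proj r x ∈ net r
  norm_sub_proj_le : ∀ r x, ‖A x - A (proj r x)‖ ≤ δ / 2 ^ r
  card_le : ∀ r, 2 * ((net r).card : ℝ) * (net (r + 1)).card ≤ Real.exp ((l * 2 ^ r) ^ 2)
  norm_le : ∀ x, ‖A x‖ ≤ δ

lemma ChainingNets.bddAbove (c : ChainingNets A δ l) (w : EuclideanSpace ℝ ι) :
    BddAbove (Set.range fun x => ‖A x w‖) := by
  refine ⟨δ * ‖w‖, ?_⟩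
  rintro _ ⟨x, rfl⟩
  exact (A x).le_of_opNorm_le (c.norm_le x) w

lemma ChainingNets.le_supNorm (c : ChainingNets A δ l) (w : EuclideanSpace ℝ ι) (x : X) :
    ‖A x w‖ ≤ supNorm A w :=
  le_ciSup (c.bddAbove w) x

variable [Nonempty X]

lemma ChainingNets.nonneg (c : ChainingNets A δ l) : 0 ≤ δ :=
  (norm_nonneg _).trans (c.norm_le (Classical.arbitrary X))

variable [DecidableEq ι]

lemma ChainingNets.expect_supNorm_radOn_le (c : ChainingNets A δ l) (η : ι → Bool) :
    𝔼 ξ, supNorm A (radOn η ξ) ≤ 𝔼 ξ, supNorm A (rad ξ) := by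
  have h1 : ∀ ξ, supNorm A (radOn η ξ) ≤
      (1 / 2) * (supNorm A (rad ξ) + supNorm A (rad (flipOff η ξ))) := by
    intro ξ
    refine ciSup_le fun x => ?_
    have h2 : radOn η ξ = (1 / 2 : ℝ) • (rad ξ + rad (flipOff η ξ)) := by
      rw [rad_add_rad_flipOff, smul_smul]; norm_num
    rw [h2, map_smul, map_add, norm_smul]
    norm_num
    linarith [norm_add_le (A x (rad ξ)) (A x (rad (flipOff η ξ))),
      c.le_supNorm (rad ξ) x, c.le_supNorm (rad (flipOff η ξ)) x]
  calc _ ≤ 𝔼 ξ, (1 / 2) * (supNorm A (rad ξ) + supNorm A (rad (flipOff η ξ))) :=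
        Finset.expect_le_expect fun ξ _ => h1 ξ
    _ = 𝔼 ξ, supNorm A (rad ξ) := by
        rw [← Finset.mul_expect, Finset.expect_add_distrib,
          Fintype.expect_equiv (flipOff η) (fun ξ => supNorm A (rad (flipOff η ξ)))
            (fun ξ => supNorm A (rad ξ)) fun _ => rfl]
        ring

variable [CompleteSpace H]

lemma exists_bilin_max_bound {κ : Type*} (η : ι → Bool) (K : Finset κ)
    (B : κ → EuclideanSpace ℝ ι →L[ℝ] H) (g : κ → H) {β s l : ℝ} (hβ : 0 ≤ β) (hs : 0 ≤ s)
    (hl : 1 ≤ l) (hB : ∀ i ∈ K, ‖B i‖ ≤ β) (hg : ∀ i ∈ K, ‖g i‖ ≤ s)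
    (hcard : 2 * (K.card : ℝ) ≤ Real.exp (l ^ 2)) :
    ∃ M : (ι → Bool) → ℝ, (∀ ξ, ∀ i ∈ K, |inner ℝ (B i (radOn η ξ)) (g i)| ≤ M ξ) ∧
      𝔼 ξ, M ξ ≤ 3 * l * (β * s) := by
  classical
  have hnorm : ∀ h ∈ K.image fun i => ContinuousLinearMap.adjoint (B i) (g i), ‖h‖ ≤ β * s := by
    intro h hh
    obtain ⟨i, hi, rfl⟩ := Finset.mem_image.1 hh
    calc _ ≤ ‖ContinuousLinearMap.adjoint (B i)‖ * ‖g i‖ := ContinuousLinearMap.le_opNorm _ _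
      _ = ‖B i‖ * ‖g i‖ := by rw [LinearIsometryEquiv.norm_map]
      _ ≤ β * s := mul_le_mul (hB i hi) (hg i hi) (norm_nonneg _) hβ
  have hcard' : 2 * ((K.image fun i => ContinuousLinearMap.adjoint (B i) (g i)).card : ℝ) ≤
      Real.exp (l ^ 2) := by
    refine le_trans ?_ hcard
    gcongr
    exact Finset.card_image_le
  obtain ⟨M, hM, hE⟩ := exists_radOn_max_bound η _ (mul_nonneg hβ hs) hl hnorm hcard'
  refine ⟨M, fun ξ i hi => ?_, hE⟩
  have := hM ξ _ (Finset.mem_image_of_mem _ hi)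
  rwa [ContinuousLinearMap.adjoint_inner_right] at this

lemma ChainingNets.exists_increment_bound (c : ChainingNets A δ l) (hl : 1 ≤ l) (η : ι → Bool)
    (sel : X × X → X) (r : ℕ) (w : EuclideanSpace ℝ ι) :
    ∃ M : (ι → Bool) → ℝ,
      (∀ ξ x, |inner ℝ ((A (c.proj (r + 1) x) - A (c.proj r x)) (radOn η ξ))
        (A (sel (c.proj r x, c.proj (r + 1) x)) w)| ≤ M ξ) ∧
      𝔼 ξ, M ξ ≤ 9 / 2 * l * δ * supNorm A w := by
  classical
  have hδ := c.nonneg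
  have h2 : (1 : ℝ) ≤ 2 ^ r := one_le_pow₀ (by norm_num)
  set K := (c.net r ×ˢ c.net (r + 1)).filter fun q => ‖A q.2 - A q.1‖ ≤ 3 / 2 * (δ / 2 ^ r)
  have hK : 2 * (K.card : ℝ) ≤ Real.exp ((l * 2 ^ r) ^ 2) := by
    refine le_trans ?_ (c.card_le r)
    rw [mul_assoc]
    gcongr
    exact_mod_cast (Finset.card_filter_le _ _).trans (le_of_eq (Finset.card_product _ _))
  obtain ⟨M, hM, hE⟩ := exists_bilin_max_bound η K (fun q => A q.2 - A q.1)
    (fun q => A (sel q) w) (β := 3 / 2 * (δ / 2 ^ r))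
    (s := supNorm A w) (l := l * 2 ^ r) (by positivity) (supNorm_nonneg w)
    (by nlinarith) (fun q hq => (Finset.mem_filter.1 hq).2) (fun q _ => c.le_supNorm w _) hK
  refine ⟨M, fun ξ x => ?_, hE.trans (le_of_eq ?_)⟩
  · refine hM ξ (c.proj r x, c.proj (r + 1) x) (Finset.mem_filter.2 ⟨Finset.mem_product.2
      ⟨c.proj_mem r x, c.proj_mem (r + 1) x⟩, ?_⟩)
    have e1 := c.norm_sub_proj_le r x
    have e2 := c.norm_sub_proj_le (r + 1) x
    have e3 : A (c.proj (r + 1) x) - A (c.proj r x) =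
        (A x - A (c.proj r x)) - (A x - A (c.proj (r + 1) x)) := by abel
    have e4 : δ / 2 ^ (r + 1) = 1 / 2 * (δ / 2 ^ r) := by rw [pow_succ]; field_simp
    rw [e4] at e2
    dsimp only
    rw [e3]
    linarith [norm_sub_le (A x - A (c.proj r x)) (A x - A (c.proj (r + 1) x))]
  · field_simp; ring

lemma ChainingNets.exists_base_bound (c : ChainingNets A δ l) (hl : 1 ≤ l) (η : ι → Bool)
    (w : EuclideanSpace ℝ ι) :
    ∃ M : (ι → Bool) → ℝ,
      (∀ ξ x, |inner ℝ (A (c.proj 0 x) (radOn η ξ)) (A (c.proj 0 x) w)| ≤ M ξ) ∧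
      𝔼 ξ, M ξ ≤ 3 * l * (δ * supNorm A w) := by
  have h0 : 2 * ((c.net 0).card : ℝ) ≤ Real.exp (l ^ 2) := by
    have h1 := c.card_le 0
    have h2 : (1 : ℝ) ≤ (c.net (0 + 1)).card := by
      exact_mod_cast Finset.card_pos.2 ⟨_, c.proj_mem (0 + 1) (Classical.arbitrary X)⟩
    rw [pow_zero, mul_one] at h1
    nlinarith [Nat.cast_nonneg (α := ℝ) (c.net 0).card]
  obtain ⟨M, hM, hE⟩ := exists_bilin_max_bound η (c.net 0) A (fun x => A x w)
    c.nonneg (supNorm_nonneg w) hl (fun x _ => c.norm_le x) (fun x _ => c.le_supNorm w x) h0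
  exact ⟨M, fun ξ x => hM ξ _ (c.proj_mem 0 x), hE⟩

/-- Chaining bound for the decoupled chaos. -/
lemma ChainingNets.expect_decoupled_le (c : ChainingNets A δ l) (hl : 1 ≤ l) {R : ℕ}
    (hR : √(Fintype.card ι) ≤ 2 ^ R) (η : ι → Bool) :
    𝔼 ξ, ⨆ x, |inner ℝ (A x (radOn η ξ)) (A x (radOn (fun s => !η s) ξ))| ≤
      9 * (R + 1) * l * δ * 𝔼 ξ, supNorm A (rad ξ) := by
  have hδ := c.nonneg
  set η' : ι → Bool := fun s => !η s with hη'
  rw [expect_radOn_compl η fun u w => ⨆ x, |inner ℝ (A x u) (A x w)|]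
  choose M₀ hM₀ hE₀ using c.exists_base_bound hl η
  choose M₁ hM₁ hE₁ using c.exists_increment_bound hl η Prod.snd
  choose M₂ hM₂ hE₂ using c.exists_increment_bound hl η' Prod.fst
  have hrest : ∀ (ζ ξ : ι → Bool) x, ‖(A x - A (c.proj R x)) (radOn ζ ξ)‖ ≤ δ := by
    intro ζ ξ x
    calc _ ≤ ‖A x - A (c.proj R x)‖ * ‖radOn ζ ξ‖ := ContinuousLinearMap.le_opNorm _ _
      _ ≤ δ / 2 ^ R * 2 ^ R := mul_le_mul (c.norm_sub_proj_le R x) ((norm_radOn_le ζ ξ).trans hR)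
          (norm_nonneg _) (by positivity)
      _ = δ := by field_simp
  have hpt : ∀ ξ ξ' : ι → Bool, ⨆ x, |inner ℝ (A x (radOn η ξ)) (A x (radOn η' ξ'))| ≤
      M₀ (radOn η' ξ') ξ + ∑ r ∈ Finset.range R, M₁ r (radOn η' ξ') ξ +
      ∑ r ∈ Finset.range R, M₂ r (radOn η ξ) ξ' + δ * supNorm A (radOn η' ξ') +
      δ * supNorm A (radOn η ξ) := by
    intro ξ ξ'
    refine ciSup_le fun x => ?_
    set u := radOn η ξ with hu
    set w := radOn η' ξ' with hw
    set D : ℕ → ℝ := fun r => inner ℝ (A (c.proj r x) u) (A (c.proj r x) w) with hD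
    have h1 := abs_le_abs_zero_add_sum_range D R
    have h2 : ∀ r, |D (r + 1) - D r| ≤ M₁ r w ξ + M₂ r u ξ' := by
      intro r
      have e1 : D (r + 1) - D r =
          inner ℝ ((A (c.proj (r + 1) x) - A (c.proj r x)) u) (A (c.proj (r + 1) x) w) +
          inner ℝ ((A (c.proj (r + 1) x) - A (c.proj r x)) w) (A (c.proj r x) u) := by
        rw [real_inner_comm (A (c.proj r x) u)]
        simp only [hD, sub_apply, inner_sub_left, inner_sub_right]
        ring
      rw [e1]
      exact (abs_add_le _ _).trans (add_le_add (hM₁ r w ξ x) (hM₂ r u ξ' x))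
    have h3 : inner ℝ (A x u) (A x w) = D R + (inner ℝ ((A x - A (c.proj R x)) u) (A x w) +
        inner ℝ (A (c.proj R x) u) ((A x - A (c.proj R x)) w)) := by
      simp only [hD, sub_apply, inner_sub_left, inner_sub_right]
      ring
    have h4 : |inner ℝ ((A x - A (c.proj R x)) u) (A x w)| ≤ δ * supNorm A w :=
      (abs_real_inner_le_norm _ _).trans
        (mul_le_mul (hrest η ξ x) (c.le_supNorm w x) (norm_nonneg _) hδ)
    have h5 : |inner ℝ (A (c.proj R x) u) ((A x - A (c.proj R x)) w)| ≤ δ * supNorm A u := by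
      rw [mul_comm]
      exact (abs_real_inner_le_norm _ _).trans
        (mul_le_mul (c.le_supNorm u _) (hrest η' ξ' x) (norm_nonneg _) (supNorm_nonneg u))
    have h6 : ∑ r ∈ Finset.range R, |D (r + 1) - D r| ≤
        ∑ r ∈ Finset.range R, M₁ r w ξ + ∑ r ∈ Finset.range R, M₂ r u ξ' := by
      rw [← Finset.sum_add_distrib]
      exact Finset.sum_le_sum fun r _ => h2 r
    have h7 : |D 0| ≤ M₀ w ξ := hM₀ w ξ x
    rw [h3]
    have h8 := abs_add_le (D R) (inner ℝ ((A x - A (c.proj R x)) u) (A x w) +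
        inner ℝ (A (c.proj R x) u) ((A x - A (c.proj R x)) w))
    have h9 := abs_add_le (inner ℝ ((A x - A (c.proj R x)) u) (A x w))
      (inner ℝ (A (c.proj R x) u) ((A x - A (c.proj R x)) w))
    linarith
  set S := 𝔼 ξ, supNorm A (rad ξ) with hS
  have hSη : 𝔼 ξ, supNorm A (radOn η ξ) ≤ S := c.expect_supNorm_radOn_le η
  have hSη' : 𝔼 ξ, supNorm A (radOn η' ξ) ≤ S := c.expect_supNorm_radOn_le η'
  have hS0 : 0 ≤ S := Finset.expect_nonneg fun _ _ => supNorm_nonneg _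
  have hl0 : 0 ≤ l := by linarith
  have b0 : 𝔼 ξ : ι → Bool, 𝔼 ξ' : ι → Bool, M₀ (radOn η' ξ') ξ ≤ 3 * l * δ * S := by
    rw [Finset.expect_comm]
    calc _ ≤ 𝔼 ξ' : ι → Bool, 3 * l * δ * supNorm A (radOn η' ξ') :=
          Finset.expect_le_expect fun ξ' _ => (hE₀ _).trans (le_of_eq (by ring))
      _ ≤ _ := by rw [← Finset.mul_expect]; gcongr
  have b1 : 𝔼 ξ : ι → Bool, 𝔼 ξ' : ι → Bool, ∑ r ∈ Finset.range R, M₁ r (radOn η' ξ') ξ ≤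
      R * (9 / 2 * l * δ * S) := by
    rw [Finset.expect_comm]
    calc _ ≤ 𝔼 ξ' : ι → Bool, R * (9 / 2 * l * δ * supNorm A (radOn η' ξ')) := by
          refine Finset.expect_le_expect fun ξ' _ => ?_
          rw [Finset.expect_sum_comm]
          exact (Finset.sum_le_sum fun r _ => hE₁ r _).trans (le_of_eq (by simp))
      _ ≤ _ := by rw [← Finset.mul_expect, ← Finset.mul_expect]; gcongr
  have b2 : 𝔼 ξ : ι → Bool, 𝔼 ξ' : ι → Bool, ∑ r ∈ Finset.range R, M₂ r (radOn η ξ) ξ' ≤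
      R * (9 / 2 * l * δ * S) := by
    calc _ ≤ 𝔼 ξ : ι → Bool, R * (9 / 2 * l * δ * supNorm A (radOn η ξ)) := by
          refine Finset.expect_le_expect fun ξ _ => ?_
          rw [Finset.expect_sum_comm]
          exact (Finset.sum_le_sum fun r _ => hE₂ r _).trans (le_of_eq (by simp))
      _ ≤ _ := by rw [← Finset.mul_expect, ← Finset.mul_expect]; gcongr
  have b3 : 𝔼 _ξ : ι → Bool, 𝔼 ξ' : ι → Bool, δ * supNorm A (radOn η' ξ') ≤ δ * S := by
    rw [Fintype.expect_const, ← Finset.mul_expect]; gcongr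
  have b4 : 𝔼 ξ : ι → Bool, 𝔼 _ξ' : ι → Bool, δ * supNorm A (radOn η ξ) ≤ δ * S := by
    simp_rw [Fintype.expect_const]
    rw [← Finset.mul_expect]; gcongr
  refine (Finset.expect_le_expect fun ξ _ => Finset.expect_le_expect fun ξ' _ =>
    hpt ξ ξ').trans ?_
  simp only [Finset.expect_add_distrib]
  have hδS : δ * S ≤ l * (δ * S) := le_mul_of_one_le_left (by positivity) hl
  nlinarith

/-- Symmetrization and decoupling: a Rademacher chaos is controlled by its decoupled versions. -/
lemma ChainingNets.expect_chaos_le (c : ChainingNets A δ l) (hl : 1 ≤ l) {R : ℕ}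
    (hR : √(Fintype.card ι) ≤ 2 ^ R) :
    𝔼 ξ : ι → Bool, ⨆ x, |‖A x (rad ξ)‖ ^ 2 - 𝔼 ζ : ι → Bool, ‖A x (rad ζ)‖ ^ 2| ≤
      36 * (R + 1) * l * δ * 𝔼 ξ, supNorm A (rad ξ) := by
  have hfac : ∀ (ξ η : ι → Bool) x, ‖A x (rad ξ)‖ ^ 2 - ‖A x (rad (flipOff η ξ))‖ ^ 2 =
      4 * inner ℝ (A x (radOn η ξ)) (A x (radOn (fun s => !η s) ξ)) := by
    intro ξ η x
    have h1 : inner ℝ (A x (rad ξ + rad (flipOff η ξ))) (A x (rad ξ - rad (flipOff η ξ))) =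
        ‖A x (rad ξ)‖ ^ 2 - ‖A x (rad (flipOff η ξ))‖ ^ 2 := by
      rw [map_add, map_sub, inner_add_left, inner_sub_right, inner_sub_right,
        real_inner_self_eq_norm_sq, real_inner_self_eq_norm_sq,
        real_inner_comm (A x (rad (flipOff η ξ)))]
      ring
    rw [← h1, rad_add_rad_flipOff, rad_sub_rad_flipOff, map_smul, map_smul, inner_smul_left,
      inner_smul_right]
    simp
    ring
  have hbdd : ∀ ξ η : ι → Bool, BddAbove (Set.range fun x =>
      |inner ℝ (A x (radOn η ξ)) (A x (radOn (fun s => !η s) ξ))|) := by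
    intro ξ η
    refine ⟨supNorm A (radOn η ξ) * supNorm A (radOn (fun s => !η s) ξ), ?_⟩
    rintro _ ⟨x, rfl⟩
    exact (abs_real_inner_le_norm _ _).trans (mul_le_mul (c.le_supNorm _ x) (c.le_supNorm _ x)
      (norm_nonneg _) (supNorm_nonneg _))
  have hpt : ∀ ξ : ι → Bool,
      ⨆ x, |‖A x (rad ξ)‖ ^ 2 - 𝔼 ζ : ι → Bool, ‖A x (rad ζ)‖ ^ 2| ≤
      4 * 𝔼 η : ι → Bool, ⨆ x,
        |inner ℝ (A x (radOn η ξ)) (A x (radOn (fun s => !η s) ξ))| := by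
    intro ξ
    refine ciSup_le fun x => ?_
    have h1 : 𝔼 ζ : ι → Bool, ‖A x (rad ζ)‖ ^ 2 = 𝔼 η : ι → Bool, ‖A x (rad (flipOff η ξ))‖ ^ 2 :=
      (Fintype.expect_equiv (flipBy ξ) _ _ fun η => rfl).symm
    have h2 : ‖A x (rad ξ)‖ ^ 2 - 𝔼 ζ : ι → Bool, ‖A x (rad ζ)‖ ^ 2 = 4 * 𝔼 η : ι → Bool,
        inner ℝ (A x (radOn η ξ)) (A x (radOn (fun s => !η s) ξ)) := by
      rw [h1, Finset.mul_expect, ← Fintype.expect_const (ι := ι → Bool) (‖A x (rad ξ)‖ ^ 2),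
        ← Finset.expect_sub_distrib]
      exact Finset.expect_congr rfl fun η _ => hfac ξ η x
    rw [h2, abs_mul, abs_of_pos (by norm_num : (0 : ℝ) < 4)]
    gcongr
    exact (Finset.abs_expect_le _ _).trans
      (Finset.expect_le_expect fun η _ => le_ciSup (hbdd ξ η) x)
  refine (Finset.expect_le_expect fun ξ _ => hpt ξ).trans ?_
  rw [← Finset.mul_expect, Finset.expect_comm]
  have h3 : 𝔼 η : ι → Bool, 𝔼 ξ : ι → Bool, ⨆ x,
      |inner ℝ (A x (radOn η ξ)) (A x (radOn (fun s => !η s) ξ))| ≤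
      9 * (R + 1) * l * δ * 𝔼 ξ, supNorm A (rad ξ) := by
    refine (Finset.expect_le_expect fun η _ => c.expect_decoupled_le hl hR η).trans ?_
    rw [Fintype.expect_const]
  linarith

end Chaos

/-! ### Empirical approximation of sparse vectors -/

lemma Real.exp_le_add_exp_sq (y : ℝ) : Real.exp y ≤ y + Real.exp (y ^ 2) := by
  have h0 := Real.add_one_le_exp (y ^ 2)
  by_cases h : |y| ≤ 1
  · have := (abs_le.1 (Real.abs_exp_sub_one_sub_id_le h)).2
    linarith
  · rcases lt_abs.1 (not_le.1 h) with h1 | h1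
    · have : Real.exp y ≤ Real.exp (y ^ 2) := Real.exp_le_exp.2 (by nlinarith)
      linarith
    · have : Real.exp y ≤ 1 := Real.exp_le_one_iff.2 (by linarith)
      nlinarith

section Empirical

variable {G τ : Type*} [Fintype G] [Fintype τ]

lemma sum_weight_exp_centered_le {q : G → ℝ} (hq : ∀ g, 0 ≤ q g) (hq1 : ∑ g, q g = 1)
    {φ : G → ℝ} {B : ℝ} (hφ : ∀ g, |φ g| ≤ B) (t : ℝ) :
    ∑ g, q g * Real.exp (t * (φ g - ∑ g', q g' * φ g')) ≤ Real.exp (4 * t ^ 2 * B ^ 2) := by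
  set μ := ∑ g', q g' * φ g' with hμ
  have hμB : |μ| ≤ B := by
    calc |μ| ≤ ∑ g, |q g * φ g| := Finset.abs_sum_le_sum_abs _ _
      _ ≤ ∑ g, q g * B := Finset.sum_le_sum fun g _ => by
          rw [abs_mul, abs_of_nonneg (hq g)]; exact mul_le_mul_of_nonneg_left (hφ g) (hq g)
      _ = B := by rw [← Finset.sum_mul, hq1, one_mul]
  calc _ ≤ ∑ g, (t * (q g * φ g - q g * μ) + q g * Real.exp (4 * t ^ 2 * B ^ 2)) := by
        refine Finset.sum_le_sum fun g _ => ?_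
        have h1 := Real.exp_le_add_exp_sq (t * (φ g - μ))
        have h2 : (t * (φ g - μ)) ^ 2 ≤ 4 * t ^ 2 * B ^ 2 := by
          have h3 : (φ g - μ) ^ 2 ≤ (2 * B) ^ 2 := by
            apply sq_le_sq'
            · linarith [(abs_le.1 (hφ g)).1, (abs_le.1 hμB).2]
            · linarith [(abs_le.1 (hφ g)).2, (abs_le.1 hμB).1]
          rw [mul_pow]
          nlinarith [sq_nonneg t]
        have h4 := Real.exp_le_exp.2 h2
        nlinarith [mul_le_mul_of_nonneg_left (h1.trans (add_le_add_right h4 _)) (hq g)]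
    _ = Real.exp (4 * t ^ 2 * B ^ 2) := by
        rw [Finset.sum_add_distrib, ← Finset.mul_sum, Finset.sum_sub_distrib, ← Finset.sum_mul,
          ← Finset.sum_mul, hq1]
        ring

/-- Some sample of size `L` has small exponential moment of its deviations from the mean,
simultaneously for all the test functions `φ i`. -/
lemma exists_sample_exp_sum_le {q : G → ℝ} (hq : ∀ g, 0 ≤ q g) (hq1 : ∑ g, q g = 1)
    {φ : τ → G → ℝ} {B : ℝ} (hφ : ∀ i g, |φ i g| ≤ B) (t : ℝ) (L : ℕ) :
    ∃ c : Fin L → G, ∑ i, (Real.exp (t * (∑ j, φ i (c j) - L * ∑ g, q g * φ i g)) +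
      Real.exp (-t * (∑ j, φ i (c j) - L * ∑ g, q g * φ i g))) ≤
      2 * Fintype.card τ * Real.exp (4 * t ^ 2 * B ^ 2 * L) := by
  have : Nonempty G := by
    by_contra hG
    rw [not_nonempty_iff] at hG
    simp at hq1
  induction L with
  | zero => exact ⟨fun j => j.elim0, by simp; linarith⟩
  | succ L ih =>
    obtain ⟨c, hc⟩ := ih
    set D : τ → ℝ := fun i => ∑ j, φ i (c j) - L * ∑ g, q g * φ i g with hD
    set d : τ → G → ℝ := fun i g => φ i g - ∑ g', q g' * φ i g' with hd
    set F : G → ℝ := fun g => ∑ i, (Real.exp (t * D i) * Real.exp (t * d i g) +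
      Real.exp (-t * D i) * Real.exp (-t * d i g)) with hF
    obtain ⟨g₀, hg₀⟩ := Finite.exists_min F
    have hcons : ∀ i, ∑ j, φ i ((Fin.cons g₀ c : Fin (L + 1) → G) j) -
        ((L + 1 : ℕ) : ℝ) * ∑ g, q g * φ i g = D i + d i g₀ := by
      intro i
      rw [Fin.sum_univ_succ]
      simp only [Fin.cons_zero, Fin.cons_succ, hD, hd]
      push_cast
      ring
    refine ⟨Fin.cons g₀ c, ?_⟩
    simp_rw [hcons, mul_add, Real.exp_add]
    have h1 : F g₀ ≤ ∑ g, q g * F g := by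
      calc F g₀ = ∑ g, q g * F g₀ := by rw [← Finset.sum_mul, hq1, one_mul]
        _ ≤ _ := Finset.sum_le_sum fun g _ => mul_le_mul_of_nonneg_left (hg₀ g) (hq g)
    have h2 : ∑ g, q g * F g = ∑ i, (Real.exp (t * D i) * ∑ g, q g * Real.exp (t * d i g) +
        Real.exp (-t * D i) * ∑ g, q g * Real.exp (-t * d i g)) := by
      simp only [hF, Finset.mul_sum]
      rw [Finset.sum_comm]
      refine Finset.sum_congr rfl fun i _ => ?_
      rw [← Finset.sum_add_distrib]
      exact Finset.sum_congr rfl fun g _ => by ring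
    calc _ ≤ ∑ i, (Real.exp (t * D i) * ∑ g, q g * Real.exp (t * d i g) +
        Real.exp (-t * D i) * ∑ g, q g * Real.exp (-t * d i g)) := h1.trans h2.le
      _ ≤ ∑ i, (Real.exp (t * D i) * Real.exp (4 * t ^ 2 * B ^ 2) +
        Real.exp (-t * D i) * Real.exp (4 * t ^ 2 * B ^ 2)) := by
          refine Finset.sum_le_sum fun i _ => ?_
          have e1 := sum_weight_exp_centered_le hq hq1 (hφ i) t
          have e2 := sum_weight_exp_centered_le hq hq1 (hφ i) (-t)
          rw [neg_sq] at e2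
          exact add_le_add (mul_le_mul_of_nonneg_left e1 (Real.exp_pos _).le)
            (mul_le_mul_of_nonneg_left e2 (Real.exp_pos _).le)
      _ = (∑ i, (Real.exp (t * D i) + Real.exp (-t * D i))) * Real.exp (4 * t ^ 2 * B ^ 2) := by
          rw [Finset.sum_mul]
          exact Finset.sum_congr rfl fun i _ => by ring
      _ ≤ (2 * Fintype.card τ * Real.exp (4 * t ^ 2 * B ^ 2 * L)) *
          Real.exp (4 * t ^ 2 * B ^ 2) := mul_le_mul_of_nonneg_right hc (Real.exp_pos _).le
      _ = _ := by
          rw [mul_assoc, ← Real.exp_add]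
          push_cast
          ring_nf

/-- Some sample of size `L` approximates the mean, simultaneously for all the test functions. -/
lemma exists_sample_abs_sub_le {q : G → ℝ} (hq : ∀ g, 0 ≤ q g) (hq1 : ∑ g, q g = 1)
    {φ : τ → G → ℝ} {B : ℝ} (hB : 0 < B) (hφ : ∀ i g, |φ i g| ≤ B) {L : ℕ} {ρ : ℝ} (hρ : 0 < ρ)
    (hL : 2 * (Fintype.card τ : ℝ) ≤ Real.exp (ρ ^ 2 * L)) :
    ∃ c : Fin L → G, ∀ i, |∑ j, φ i (c j) - L * ∑ g, q g * φ i g| ≤ 4 * B * ρ * L := by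
  set t := ρ / (2 * B) with ht
  have ht0 : 0 < t := by positivity
  obtain ⟨c, hc⟩ := exists_sample_exp_sum_le hq hq1 hφ t L
  refine ⟨c, fun i => ?_⟩
  set D := ∑ j, φ i (c j) - L * ∑ g, q g * φ i g with hD
  have htB : 4 * t ^ 2 * B ^ 2 = ρ ^ 2 := by rw [ht]; field_simp; norm_num
  have h1 : Real.exp (t * D) + Real.exp (-t * D) ≤ Real.exp (2 * ρ ^ 2 * L) := by
    calc _ ≤ _ := Finset.single_le_sum (f := fun i => Real.exp (t *
          (∑ j, φ i (c j) - L * ∑ g, q g * φ i g)) + Real.exp (-t *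
          (∑ j, φ i (c j) - L * ∑ g, q g * φ i g))) (fun _ _ => by positivity) (Finset.mem_univ i)
      _ ≤ _ := hc
      _ ≤ Real.exp (ρ ^ 2 * L) * Real.exp (ρ ^ 2 * L) := by rw [htB]; gcongr
      _ = _ := by rw [← Real.exp_add]; ring_nf
  have h2 : t * D ≤ 2 * ρ ^ 2 * L := Real.exp_le_exp.1 (by linarith [Real.exp_pos (-t * D)])
  have h3 : -t * D ≤ 2 * ρ ^ 2 * L := Real.exp_le_exp.1 (by linarith [Real.exp_pos (t * D)])
  have h4 : t * (4 * B * ρ * L) = 2 * ρ ^ 2 * L := by rw [ht]; field_simp; norm_num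
  rw [abs_le]
  constructor
  · refine le_of_mul_le_mul_left ?_ ht0
    linarith
  · exact le_of_mul_le_mul_left (by linarith) ht0

end Empirical

section Sparse

variable {n k : ℕ}

lemma norm2_sq {n : ℕ} (x : Fin n → ℝ) : norm2 x ^ 2 = ∑ j, x j ^ 2 :=
  Real.sq_sqrt (Finset.sum_nonneg fun _ _ => sq_nonneg _)

lemma sum_sq_of_mem_TkR {x : Fin n → ℝ} (hx : x ∈ TkR n k) : ∑ t, x t ^ 2 = 1 := by
  rw [← norm2_sq, hx.1, one_pow]

lemma sum_abs_le_of_mem_TkR {x : Fin n → ℝ} (hx : x ∈ TkR n k) : ∑ t, |x t| ≤ √k := by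
  obtain ⟨s, hs, h0⟩ := hx.2
  have h1 : ∑ t, |x t| = ∑ t ∈ s, |x t| :=
    (Finset.sum_subset (Finset.subset_univ s) fun t _ ht => by simp [h0 t ht]).symm
  apply Real.le_sqrt_of_sq_le
  rw [h1]
  calc (∑ t ∈ s, |x t|) ^ 2 ≤ s.card * ∑ t ∈ s, |x t| ^ 2 := sq_sum_le_card_mul_sum_sq
    _ ≤ k * 1 := by
        refine mul_le_mul (by exact_mod_cast hs) ?_ (Finset.sum_nonneg fun _ _ => by positivity)
          (by positivity)
        rw [← sum_sq_of_mem_TkR hx]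
        simp_rw [sq_abs]
        exact Finset.sum_le_sum_of_subset_of_nonneg (Finset.subset_univ _)
          fun _ _ _ => sq_nonneg _
    _ = k := mul_one _

lemma nonempty_TkR (hn : 0 < n) (hk : 0 < k) : Nonempty (TkR n k) := by
  refine ⟨Pi.single ⟨0, hn⟩ 1, ?_, {⟨0, hn⟩}, by simpa using Nat.succ_le_of_lt hk, fun t ht => ?_⟩
  · rw [norm2, Finset.sum_eq_single ⟨0, hn⟩] <;> simp +contextual
  · simp only [Finset.mem_singleton] at ht
    simp [ht]

/-- The value of a linear functional at the vertices of the cross-polytope of radius `√k`. -/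
def vertexValue (k : ℕ) (f : Fin n → ℝ) : Option (Fin n × Bool) → ℝ
  | none => 0
  | some (t, b) => √k * (rsign b * f t)

lemma exists_sample_TkR {τ : Type*} [Fintype τ] (hk : 0 < k) {f : τ → Fin n → ℝ}
    (hf : ∀ i t, |f i t| ≤ 1) {L : ℕ} {ρ : ℝ} (hρ : 0 < ρ)
    (hL : 2 * (Fintype.card τ : ℝ) ≤ Real.exp (ρ ^ 2 * L)) {x : Fin n → ℝ} (hx : x ∈ TkR n k) :
    ∃ c : Fin L → Option (Fin n × Bool),
      ∀ i, |∑ j, vertexValue k (f i) (c j) - L * ∑ t, f i t * x t| ≤ 4 * √k * ρ * L := by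
  have hk0 : 0 < √(k : ℝ) := by positivity
  set q : Option (Fin n × Bool) → ℝ := fun g => g.elim (1 - (∑ t, |x t|) / √k)
    fun a => max (rsign a.2 * x a.1) 0 / √k with hq
  have hpm : ∀ y : ℝ, max y 0 + max (-y) 0 = |y| ∧ max y 0 - max (-y) 0 = y := by
    intro y
    rcases le_total 0 y with h | h
    · rw [max_eq_left h, max_eq_right (by linarith), abs_of_nonneg h]; simp
    · rw [max_eq_right h, max_eq_left (by linarith), abs_of_nonpos h]; simp
  have hq0 : ∀ g, 0 ≤ q g := by
    rintro (_ | ⟨t, b⟩)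
    · simp only [hq, Option.elim_none, sub_nonneg]
      rw [div_le_one hk0]
      exact sum_abs_le_of_mem_TkR hx
    · simp only [hq, Option.elim_some]
      positivity
  have hq1 : ∑ g, q g = 1 := by
    rw [Fintype.sum_option, Fintype.sum_prod_type]
    have : ∀ t, ∑ b, q (some (t, b)) = |x t| / √k := by
      intro t
      simp only [hq, Fintype.sum_bool, rsign]
      simp only [if_true, Bool.false_eq_true, if_false, Option.elim_some, one_mul, neg_mul]
      rw [← add_div, (hpm (x t)).1]
    simp_rw [this, ← Finset.sum_div]
    simp [hq]
  have hmean : ∀ i, ∑ g, q g * vertexValue k (f i) g = ∑ t, f i t * x t := by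
    intro i
    rw [Fintype.sum_option, Fintype.sum_prod_type]
    simp only [vertexValue, mul_zero, zero_add]
    refine Finset.sum_congr rfl fun t _ => ?_
    simp only [hq, Fintype.sum_bool, rsign]
    simp only [if_true, Bool.false_eq_true, if_false, Option.elim_some, one_mul, neg_mul]
    have h1 : ∀ a : ℝ, a / √k * (√k * f i t) = a * f i t := fun a => by field_simp
    rw [mul_neg, mul_neg, h1, h1, ← sub_eq_add_neg, ← sub_mul, (hpm (x t)).2, mul_comm]
  have hv : ∀ i g, |vertexValue k (f i) g| ≤ √k := by
    rintro i (_ | ⟨t, b⟩)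
    · simp [vertexValue]
    · rw [vertexValue, abs_mul, abs_mul, abs_rsign, one_mul, abs_of_pos hk0]
      exact mul_le_of_le_one_right hk0.le (hf i t)
  obtain ⟨c, hc⟩ := exists_sample_abs_sub_le hq0 hq1 hk0 hv hρ hL
  exact ⟨c, fun i => by rw [← hmean i]; exact hc i⟩

/-- Metric entropy of the sparse vectors with respect to a maximum of linear functionals. -/
lemma exists_net_TkR {τ : Type*} [Fintype τ] (hn : 0 < n) (hk : 0 < k) {f : τ → Fin n → ℝ}
    (hf : ∀ i t, |f i t| ≤ 1) {L : ℕ} (hL0 : 0 < L) {ρ : ℝ} (hρ : 0 < ρ)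
    (hL : 2 * (Fintype.card τ : ℝ) ≤ Real.exp (ρ ^ 2 * L)) :
    ∃ (N : Finset (TkR n k)) (proj : TkR n k → TkR n k), N.card ≤ (2 * n + 1) ^ L ∧
      (∀ x, proj x ∈ N) ∧
      ∀ (x : TkR n k) i, |∑ t, f i t * ((x : Fin n → ℝ) - (proj x : Fin n → ℝ)) t| ≤ 8 * √k * ρ := by
  classical
  have := nonempty_TkR hn hk
  choose code hcode using fun x : TkR n k => exists_sample_TkR hk hf hρ hL x.2
  refine ⟨Finset.univ.image (Function.invFun code), fun x => Function.invFun code (code x),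
    ?_, fun x => Finset.mem_image_of_mem _ (Finset.mem_univ _), fun x i => ?_⟩
  · refine Finset.card_image_le.trans (le_of_eq ?_)
    simp [Fintype.card_option]
    ring
  · set y := Function.invFun code (code x) with hy
    have hxy : code y = code x := Function.invFun_eq ⟨x, rfl⟩
    have h1 := hcode x i
    have h2 := hcode y i
    rw [hxy] at h2
    have hL' : (0 : ℝ) < L := by exact_mod_cast hL0
    have h3 : ∑ t, f i t * ((x : Fin n → ℝ) - (y : Fin n → ℝ)) t =
        ∑ t, f i t * (x : Fin n → ℝ) t - ∑ t, f i t * (y : Fin n → ℝ) t := by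
      simp [mul_sub]
    rw [h3]
    rw [abs_le] at h1 h2 ⊢
    constructor
    · refine le_of_mul_le_mul_left ?_ hL'
      linarith
    · refine le_of_mul_le_mul_left ?_ hL'
      linarith

end Sparse

/-! ### Chaos indexed by sparse vectors -/

section SparseChaos

variable {n k p : ℕ} {ι τ H : Type*} [Fintype ι] [Fintype τ]
  [NormedAddCommGroup H] [InnerProductSpace ℝ H]

lemma two_thirds_le_log (hn : 2 ≤ n) : 2 / 3 ≤ Real.log n := by
  have h1 : Real.log 2 ≤ Real.log n :=
    Real.log_le_log (by norm_num) (by exact_mod_cast hn)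
  linarith [Real.log_two_gt_d9]

lemma four_mul_le_exp_three_log (hn : 2 ≤ n) : 4 * (n : ℝ) ≤ Real.exp (3 * Real.log n) := by
  have h2 : (2 : ℝ) ≤ n := by exact_mod_cast hn
  have h3 : Real.exp (3 * Real.log n) = (n : ℝ) ^ 3 := by
    rw [mul_comm, Real.exp_mul, Real.exp_log (by linarith)]
    norm_cast
  rw [h3]
  nlinarith [mul_le_mul h2 h2 (by norm_num) (by linarith)]

lemma nonempty_chainingNets (hn : 2 ≤ n) (hk : 0 < k) (hp : 0 < p)
    (hτ : Fintype.card τ ≤ 2 * n) {f : τ → Fin n → ℝ} (hf : ∀ i t, |f i t| ≤ 1)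
    (A : (Fin n → ℝ) →ₗ[ℝ] EuclideanSpace ℝ ι →L[ℝ] H)
    (hA : ∀ x β, 0 ≤ β → (∀ i, |∑ t, f i t * x t| ≤ β) → ‖A x‖ ≤ 2 / √p * β) :
    Nonempty (ChainingNets (fun x : TkR n k => A x) (32 * (√k / √p)) (7 * Real.log n)) := by
  have hlog := two_thirds_le_log hn
  have hp0 : 0 < √(p : ℝ) := by positivity
  have h4n := four_mul_le_exp_three_log hn
  set L₀ := ⌈Real.log n⌉₊ with hL₀
  have hL₀1 : Real.log n ≤ L₀ := Nat.le_ceil _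
  have hL₀2 : (L₀ : ℝ) ≤ 5 / 2 * Real.log n := by
    have := Nat.ceil_lt_add_one (a := Real.log n) (by linarith)
    linarith
  have hL₀0 : 0 < L₀ := Nat.ceil_pos.2 (by linarith)
  have hcond : ∀ r : ℕ, 2 * (Fintype.card τ : ℝ) ≤
      Real.exp ((2 / 2 ^ r : ℝ) ^ 2 * ((4 ^ r * L₀ : ℕ) : ℝ)) := by
    intro r
    have h1 : (2 / 2 ^ r : ℝ) ^ 2 * ((4 ^ r * L₀ : ℕ) : ℝ) = 4 * L₀ := by
      have : (4 : ℝ) ^ r = (2 ^ r) ^ 2 := by rw [← pow_mul, mul_comm, pow_mul]; norm_num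
      push_cast
      rw [this]
      field_simp
      norm_num
    have h2 : (Fintype.card τ : ℝ) ≤ 2 * n := by exact_mod_cast hτ
    rw [h1]
    calc 2 * (Fintype.card τ : ℝ) ≤ 4 * n := by linarith
      _ ≤ Real.exp (3 * Real.log n) := h4n
      _ ≤ _ := Real.exp_le_exp.2 (by linarith)
  choose N proj hcard hmem happrox using fun r : ℕ => exists_net_TkR (k := k) (by omega) hk hf
    (L := 4 ^ r * L₀) (by positivity) (ρ := 2 / 2 ^ r) (by positivity) (hcond r)
  have hcardExp : ∀ r, ((N r).card : ℝ) ≤ Real.exp (15 / 2 * Real.log n ^ 2 * 4 ^ r) := by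
    intro r
    calc ((N r).card : ℝ) ≤ (2 * n + 1 : ℝ) ^ (4 ^ r * L₀) := by exact_mod_cast hcard r
      _ ≤ (Real.exp (3 * Real.log n)) ^ (4 ^ r * L₀) := by
          have h2 : (2 : ℝ) ≤ n := by exact_mod_cast hn
          gcongr
          linarith
      _ = Real.exp (3 * Real.log n * 4 ^ r * L₀) := by
          rw [← Real.exp_nat_mul]
          push_cast
          ring_nf
      _ ≤ _ := by
          apply Real.exp_le_exp.2
          calc 3 * Real.log n * 4 ^ r * L₀ ≤ 3 * Real.log n * 4 ^ r * (5 / 2 * Real.log n) := by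
                gcongr
            _ = _ := by ring
  refine ⟨⟨N, proj, hmem, fun r x => ?_, fun r => ?_, fun x => ?_⟩⟩
  · rw [← map_sub]
    refine (hA _ _ (by positivity) (happrox r x)).trans (le_of_eq ?_)
    field_simp
    norm_num
  · have h2 : (2 : ℝ) ≤ Real.exp (Real.log n) := by
      rw [Real.exp_log (by positivity)]; exact_mod_cast hn
    have h4 : (1 : ℝ) ≤ 4 ^ r := one_le_pow₀ (by norm_num)
    calc 2 * ((N r).card : ℝ) * (N (r + 1)).card ≤ Real.exp (Real.log n) *
          Real.exp (15 / 2 * Real.log n ^ 2 * 4 ^ r) *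
          Real.exp (15 / 2 * Real.log n ^ 2 * 4 ^ (r + 1)) := by
          gcongr
          · exact hcardExp r
          · exact hcardExp (r + 1)
      _ = Real.exp (Real.log n + 75 / 2 * Real.log n ^ 2 * 4 ^ r) := by
          rw [← Real.exp_add, ← Real.exp_add]
          ring_nf
      _ ≤ _ := by
          apply Real.exp_le_exp.2
          have h5 : (7 * Real.log n * 2 ^ r) ^ 2 = 49 * Real.log n ^ 2 * 4 ^ r := by
            have : (4 : ℝ) ^ r = (2 ^ r) ^ 2 := by rw [← pow_mul, mul_comm, pow_mul]; norm_num
            rw [this]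
            ring
          rw [h5]
          have h6 : Real.log n ≤ 3 / 2 * Real.log n ^ 2 := by nlinarith
          have h7 : Real.log n ^ 2 ≤ Real.log n ^ 2 * 4 ^ r :=
            le_mul_of_one_le_right (by positivity) h4
          nlinarith
  · have h1 : ∀ i, |∑ t, f i t * (x : Fin n → ℝ) t| ≤ √k := by
      intro i
      refine le_trans ?_ (sum_abs_le_of_mem_TkR x.2)
      refine (Finset.abs_sum_le_sum_abs _ _).trans (Finset.sum_le_sum fun t _ => ?_)
      rw [abs_mul]
      exact mul_le_of_le_one_left (abs_nonneg _) (hf i t)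
    refine (hA _ _ (Real.sqrt_nonneg _) h1).trans ?_
    rw [div_mul_eq_mul_div, mul_div_assoc]
    gcongr
    norm_num

lemma exists_sqrt_le_two_pow (hn : 2 ≤ n) :
    ∃ R : ℕ, √(n : ℝ) ≤ 2 ^ R ∧ (R : ℝ) + 1 ≤ 5 * Real.log n := by
  refine ⟨Nat.clog 2 n, ?_, ?_⟩
  · have h1 : (n : ℝ) ≤ 2 ^ Nat.clog 2 n := by exact_mod_cast Nat.le_pow_clog (by norm_num) n
    have h2 : (2 : ℝ) ≤ n := by exact_mod_cast hn
    refine le_trans ?_ h1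
    rw [Real.sqrt_le_left (by linarith)]
    nlinarith
  · have h0 : 0 < Nat.clog 2 n := Nat.clog_pos (by norm_num) hn
    have h1 : 2 ^ (Nat.clog 2 n - 1) < n := by
      have := Nat.pow_pred_clog_lt_self (b := 2) (by norm_num) (x := n) (by omega)
      simpa using this
    have h2 : ((2 : ℝ) ^ (Nat.clog 2 n - 1)) ≤ n := by exact_mod_cast h1.le
    have h3 := Real.log_le_log (by positivity) h2
    rw [Real.log_pow, Nat.cast_sub h0] at h3
    have h4 := two_thirds_le_log hn
    have h5 := Real.log_two_gt_d9
    push_cast at h3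
    have h6 : (1 : ℝ) ≤ Nat.clog 2 n := by exact_mod_cast h0
    nlinarith

variable [DecidableEq ι]

lemma bddAbove_chaos_TkR (hn : 2 ≤ n) (hk : 0 < k) (hp : 0 < p)
    (hτ : Fintype.card τ ≤ 2 * n) {f : τ → Fin n → ℝ}
    (hf : ∀ i t, |f i t| ≤ 1) (A : (Fin n → ℝ) →ₗ[ℝ] EuclideanSpace ℝ ι →L[ℝ] H)
    (hA : ∀ x β, 0 ≤ β → (∀ i, |∑ t, f i t * x t| ≤ β) → ‖A x‖ ≤ 2 / √p * β) (ξ : ι → Bool) :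
    BddAbove (Set.range fun x : TkR n k =>
      |‖A x (rad ξ)‖ ^ 2 - 𝔼 ζ : ι → Bool, ‖A x (rad ζ)‖ ^ 2|) := by
  obtain ⟨c⟩ := nonempty_chainingNets (k := k) hn hk hp hτ hf A hA
  set S := supNorm fun x : TkR n k => A x with hS
  refine ⟨S (rad ξ) ^ 2 + 𝔼 ζ : ι → Bool, S (rad ζ) ^ 2, ?_⟩
  rintro _ ⟨x, rfl⟩
  have h1 : ∀ ζ : ι → Bool, ‖A x (rad ζ)‖ ^ 2 ≤ S (rad ζ) ^ 2 := fun ζ =>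
    pow_le_pow_left₀ (norm_nonneg _) (c.le_supNorm (rad ζ) x) 2
  have h2 : 𝔼 ζ : ι → Bool, ‖A x (rad ζ)‖ ^ 2 ≤ 𝔼 ζ : ι → Bool, S (rad ζ) ^ 2 :=
    Finset.expect_le_expect fun ζ _ => h1 ζ
  have h3 : 0 ≤ 𝔼 ζ : ι → Bool, ‖A x (rad ζ)‖ ^ 2 := Finset.expect_nonneg fun _ _ => by positivity
  have h4 := h1 ξ
  have h5 : 0 ≤ ‖A x (rad ξ)‖ ^ 2 := by positivity
  dsimp only
  rw [abs_le]
  constructor <;> linarith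

variable [CompleteSpace H]

/-- Uniform deviation of a quadratic Rademacher chaos indexed by sparse unit vectors. -/
lemma expect_chaos_TkR_le (hn : 2 ≤ n) (hk : 0 < k) (hp : 0 < p)
    (hι : Fintype.card ι ≤ n) (hτ : Fintype.card τ ≤ 2 * n) {f : τ → Fin n → ℝ}
    (hf : ∀ i t, |f i t| ≤ 1) (A : (Fin n → ℝ) →ₗ[ℝ] EuclideanSpace ℝ ι →L[ℝ] H)
    (hA : ∀ x β, 0 ≤ β → (∀ i, |∑ t, f i t * x t| ≤ β) → ‖A x‖ ≤ 2 / √p * β) :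
    𝔼 ξ : ι → Bool, ⨆ x : TkR n k,
        |‖A x (rad ξ)‖ ^ 2 - 𝔼 ζ : ι → Bool, ‖A x (rad ζ)‖ ^ 2| ≤
      40320 * Real.log n ^ 2 * (√k / √p) *
        𝔼 ξ : ι → Bool, supNorm (fun x : TkR n k => A x) (rad ξ) := by
  have := nonempty_TkR (n := n) (by omega) hk
  obtain ⟨c⟩ := nonempty_chainingNets (k := k) hn hk hp hτ hf A hA
  obtain ⟨R, hR, hR'⟩ := exists_sqrt_le_two_pow hn
  have hlog := two_thirds_le_log hn
  have hS : 0 ≤ 𝔼 ξ : ι → Bool, supNorm (fun x : TkR n k => A x) (rad ξ) :=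
    Finset.expect_nonneg fun _ _ => supNorm_nonneg _
  refine (c.expect_chaos_le (by linarith) (R := R) ?_).trans ?_
  · refine le_trans (Real.sqrt_le_sqrt ?_) hR
    exact_mod_cast hι
  · refine mul_le_mul_of_nonneg_right ?_ hS
    calc _ ≤ 36 * (5 * Real.log n) * (7 * Real.log n) * (32 * (√k / √p)) := by gcongr
      _ = _ := by ring

/-- Self-bounding form of the deviation inequality, in terms of the mean of the chaos. -/
lemma expect_chaos_TkR_le_mul (hn : 2 ≤ n) (hk : 0 < k) (hp : 0 < p)
    (hι : Fintype.card ι ≤ n) (hτ : Fintype.card τ ≤ 2 * n) {f : τ → Fin n → ℝ}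
    (hf : ∀ i t, |f i t| ≤ 1) (A : (Fin n → ℝ) →ₗ[ℝ] EuclideanSpace ℝ ι →L[ℝ] H)
    (hA : ∀ x β, 0 ≤ β → (∀ i, |∑ t, f i t * x t| ≤ β) → ‖A x‖ ≤ 2 / √p * β)
    {K Q : ℝ} (hK : 40320 * Real.log n ^ 2 * (√k / √p) ≤ K) (hK' : K ≤ 1 / 8)
    (hQ : ∀ x : TkR n k, 𝔼 ζ : ι → Bool, ‖A x (rad ζ)‖ ^ 2 ≤ Q) :
    𝔼 ξ : ι → Bool, ⨆ x : TkR n k,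
        |‖A x (rad ξ)‖ ^ 2 - 𝔼 ζ : ι → Bool, ‖A x (rad ζ)‖ ^ 2| ≤ K * (1 + Q) := by
  have := nonempty_TkR (n := n) (by omega) hk
  have h1 := expect_chaos_TkR_le (k := k) hn hk hp hι hτ hf A hA
  set D : (ι → Bool) → ℝ := fun ξ => ⨆ x : TkR n k,
    |‖A x (rad ξ)‖ ^ 2 - 𝔼 ζ : ι → Bool, ‖A x (rad ζ)‖ ^ 2| with hD
  set S := supNorm fun x : TkR n k => A x with hS
  have h2 : ∀ ξ, S (rad ξ) ≤ 1 / 2 * (1 + Q + D ξ) := by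
    intro ξ
    refine ciSup_le fun x => ?_
    have e1 := le_ciSup (bddAbove_chaos_TkR (k := k) hn hk hp hτ hf A hA ξ) x
    have e2 := (le_abs_self _).trans e1
    have e3 := hQ x
    nlinarith [sq_nonneg (‖A x (rad ξ)‖ - 1)]
  have h3 : 𝔼 ξ, S (rad ξ) ≤ 1 / 2 * (1 + Q + 𝔼 ξ, D ξ) := by
    refine (Finset.expect_le_expect fun ξ _ => h2 ξ).trans (le_of_eq ?_)
    rw [← Finset.mul_expect, Finset.expect_add_distrib, Fintype.expect_const]
  have hS0 : 0 ≤ 𝔼 ξ, S (rad ξ) := Finset.expect_nonneg fun _ _ => supNorm_nonneg _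
  have hD0 : 0 ≤ 𝔼 ξ, D ξ :=
    Finset.expect_nonneg fun _ _ => Real.iSup_nonneg fun _ => abs_nonneg _
  have hK0 : 0 ≤ K := le_trans (by positivity) hK
  have hQ0 : 0 ≤ Q := le_trans (Finset.expect_nonneg fun _ _ => by positivity)
    (hQ (Classical.arbitrary _))
  have h4 : 𝔼 ξ, D ξ ≤ K * (1 / 2 * (1 + Q + 𝔼 ξ, D ξ)) :=
    h1.trans (mul_le_mul hK h3 hS0 hK0)
  nlinarith [mul_le_mul_of_nonneg_right hK' hD0, mul_nonneg hK0 hQ0]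

end SparseChaos

/-! ### Convolution operators on finite abelian groups -/

section Convolution

variable {G : Type*} [AddCommGroup G] [Fintype G]

lemma AddChar.sum_norm_sq_transform (g : G → ℝ) :
    ∑ ψ : AddChar G ℂ, ‖∑ s, (g s : ℂ) * ψ s‖ ^ 2 = Fintype.card G * ∑ s, g s ^ 2 := by
  classical
  have h1 : ∀ ψ : AddChar G ℂ, ((‖∑ s, (g s : ℂ) * ψ s‖ ^ 2 : ℝ) : ℂ) =
      ∑ s, ∑ t, (g s : ℂ) * g t * ψ (s - t) := by
    intro ψ
    push_cast
    rw [← Complex.mul_conj', map_sum, Finset.sum_mul_sum]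
    refine Finset.sum_congr rfl fun s _ => Finset.sum_congr rfl fun t _ => ?_
    rw [sub_eq_add_neg, AddChar.map_add_eq_mul, AddChar.map_neg_eq_conj, map_mul,
      Complex.conj_ofReal]
    ring
  have h2 : ((∑ ψ : AddChar G ℂ, ‖∑ s, (g s : ℂ) * ψ s‖ ^ 2 : ℝ) : ℂ) =
      ((Fintype.card G * ∑ s, g s ^ 2 : ℝ) : ℂ) := by
    rw [Complex.ofReal_sum]
    simp_rw [h1]
    rw [Finset.sum_comm]
    simp_rw [Finset.sum_comm (s := (Finset.univ : Finset (AddChar G ℂ))), ← Finset.mul_sum,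
      AddChar.sum_apply_eq_ite, sub_eq_zero]
    push_cast
    rw [Finset.mul_sum]
    refine Finset.sum_congr rfl fun s _ => ?_
    simp
    ring
  exact_mod_cast h2

lemma AddChar.transform_convolution (x u : G → ℝ) (ψ : AddChar G ℂ) :
    ∑ a, ((∑ s, x (a - s) * u s : ℝ) : ℂ) * ψ a =
      (∑ t, (x t : ℂ) * ψ t) * ∑ s, (u s : ℂ) * ψ s := by
  rw [Finset.mul_sum]
  push_cast
  simp_rw [Finset.sum_mul]
  rw [Finset.sum_comm]
  refine Finset.sum_congr rfl fun s _ => ?_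
  refine Fintype.sum_equiv (Equiv.subRight s) _ _ fun a => ?_
  have : ψ a = ψ (a - s) * ψ s := by rw [← AddChar.map_add_eq_mul, sub_add_cancel]
  rw [this, Equiv.subRight_apply]
  ring

lemma sum_sq_convolution_le (x u : G → ℝ) {β : ℝ}
    (h : ∀ ψ : AddChar G ℂ, ‖∑ t, (x t : ℂ) * ψ t‖ ≤ β) :
    ∑ a, (∑ s, x (a - s) * u s) ^ 2 ≤ β ^ 2 * ∑ s, u s ^ 2 := by
  have hcard : (0 : ℝ) < Fintype.card G := by exact_mod_cast Fintype.card_pos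
  refine le_of_mul_le_mul_left ?_ hcard
  rw [← AddChar.sum_norm_sq_transform]
  calc _ ≤ ∑ ψ : AddChar G ℂ, β ^ 2 * ‖∑ s, (u s : ℂ) * ψ s‖ ^ 2 := by
        refine Finset.sum_le_sum fun ψ _ => ?_
        rw [AddChar.transform_convolution, norm_mul, mul_pow]
        gcongr
        exact h ψ
    _ = _ := by rw [← Finset.mul_sum, AddChar.sum_norm_sq_transform]; ring

end Convolution

/-! ### Random matrices acting on sign vectors -/

section MatrixAction

variable {ι κ : Type*} [Fintype ι] [DecidableEq ι] [Fintype κ]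

lemma expect_sq_sum_mul_rsign (a : ι → ℝ) :
    𝔼 ξ : ι → Bool, (∑ s, a s * rsign (ξ s)) ^ 2 = ∑ s, a s ^ 2 := by
  have hoff : ∀ s t, s ≠ t → 𝔼 ξ : ι → Bool, rsign (ξ s) * rsign (ξ t) = 0 := by
    intro s t hst
    have h1 : 𝔼 ξ : ι → Bool, rsign (ξ s) * rsign (ξ t) =
        𝔼 ξ : ι → Bool, -(rsign (ξ s) * rsign (ξ t)) := by
      refine Fintype.expect_equiv (flipOff fun u => decide (u ≠ s)) _ _ fun ξ => ?_
      cases h : ξ s <;> cases h' : ξ t <;> simp [flipOff, hst.symm, rsign, h, h']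
    rw [Finset.expect_neg_distrib] at h1
    linarith
  have h2 : ∀ ξ : ι → Bool, (∑ s, a s * rsign (ξ s)) ^ 2 =
      ∑ s, ∑ t, a s * a t * (rsign (ξ s) * rsign (ξ t)) := by
    intro ξ
    rw [sq, Finset.sum_mul_sum]
    exact Finset.sum_congr rfl fun s _ => Finset.sum_congr rfl fun t _ => by ring
  simp_rw [h2]
  rw [Finset.expect_sum_comm]
  refine Finset.sum_congr rfl fun s _ => ?_
  rw [Finset.expect_sum_comm, Finset.sum_eq_single s]
  · simp_rw [rsign_mul_self, mul_one, Fintype.expect_const, sq]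
  · intro t _ hts
    rw [← Finset.mul_expect, hoff s t hts.symm, mul_zero]
  · simp

/-- A real matrix as a continuous linear map between Euclidean spaces. -/
def matrixCLM : Matrix κ ι ℝ ≃ₗ[ℝ] (EuclideanSpace ℝ ι →L[ℝ] EuclideanSpace ℝ κ) :=
  Matrix.toEuclideanLin ≪≫ₗ LinearMap.toContinuousLinearMap

lemma norm_sq_matrixCLM (M : Matrix κ ι ℝ) (u : EuclideanSpace ℝ ι) :
    ‖matrixCLM M u‖ ^ 2 = ∑ i, (∑ s, M i s * u s) ^ 2 := by
  rw [EuclideanSpace.real_norm_sq_eq]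
  rfl

lemma norm_matrixCLM_le (M : Matrix κ ι ℝ) {K : ℝ} (hK : 0 ≤ K)
    (h : ∀ u : ι → ℝ, ∑ i, (∑ s, M i s * u s) ^ 2 ≤ K ^ 2 * ∑ s, u s ^ 2) :
    ‖matrixCLM M‖ ≤ K := by
  refine ContinuousLinearMap.opNorm_le_bound _ hK fun u => ?_
  refine le_of_sq_le_sq ?_ (by positivity)
  rw [norm_sq_matrixCLM, mul_pow, EuclideanSpace.real_norm_sq_eq]
  exact h u

lemma expect_norm_sq_matrixCLM (M : Matrix κ ι ℝ) :
    𝔼 ξ : ι → Bool, ‖matrixCLM M (rad ξ)‖ ^ 2 = ∑ i, ∑ s, M i s ^ 2 := by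
  simp_rw [norm_sq_matrixCLM]
  rw [Finset.expect_sum_comm]
  exact Finset.sum_congr rfl fun i _ => expect_sq_sum_mul_rsign (M i)

end MatrixAction

/-! ### The two chaos processes attached to the sign-randomized partial circulant ensemble -/

section Circulant

variable {n k p : ℕ} {J P : Type*} [Fintype J] [Fintype P] [DecidableEq P]

/-- The entries of `H_σ x` in the rows selected by `e`. -/
def circRows (e : J → Fin n) (σ : Fin n → Bool) (x : Fin n → ℝ) (j : J) : ℝ :=
  ∑ t, rsign (σ (e j - t)) * x t

/-- The linear map `u ↦ (c_j (x ∗ u)_{e j})_j`, depending linearly on `x`. -/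
def weightedConv (c : J → ℝ) (e : J → Fin n) :
    (Fin n → ℝ) →ₗ[ℝ] EuclideanSpace ℝ (Fin n) →L[ℝ] EuclideanSpace ℝ J :=
  matrixCLM.toLinearMap ∘ₗ
    { toFun := fun x => Matrix.of fun j s => c j * x (e j - s)
      map_add' := fun x y => by ext; simp [mul_add]
      map_smul' := fun a x => by ext; simp [mul_left_comm] }

/-- The linear map `u ↦ (∑_{j ∈ block i} c_j (H_σ x)_{e j} u_j)_i`, depending linearly on `x`. -/
def blockConv [DecidableEq J] (blk : J → P) (c : J → ℝ) (e : J → Fin n) (σ : Fin n → Bool) :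
    (Fin n → ℝ) →ₗ[ℝ] EuclideanSpace ℝ J →L[ℝ] EuclideanSpace ℝ P :=
  matrixCLM.toLinearMap ∘ₗ
    { toFun := fun x => Matrix.of fun i j => (if blk j = i then c j else 0) * circRows e σ x j
      map_add' := fun x y => by
        ext; simp only [circRows, Matrix.of_apply, Pi.add_apply, Matrix.add_apply, mul_add,
          Finset.sum_add_distrib]
      map_smul' := fun a x => by
        ext; simp only [circRows, Matrix.of_apply, Pi.smul_apply, Matrix.smul_apply, smul_eq_mul,
          RingHom.id_apply, mul_left_comm _ a, ← Finset.mul_sum] }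

variable {c : J → ℝ} {e : J → Fin n} {blk : J → P} {σ : Fin n → Bool}

lemma norm_sq_weightedConv (x : Fin n → ℝ) (u : EuclideanSpace ℝ (Fin n)) :
    ‖weightedConv c e x u‖ ^ 2 = ∑ j, (∑ s, c j * x (e j - s) * u s) ^ 2 :=
  norm_sq_matrixCLM _ _

lemma norm_sq_blockConv [DecidableEq J] (x : Fin n → ℝ) (u : EuclideanSpace ℝ J) :
    ‖blockConv blk c e σ x u‖ ^ 2 =
      ∑ i, (∑ j, (if blk j = i then c j else 0) * circRows e σ x j * u j) ^ 2 :=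
  norm_sq_matrixCLM _ _

lemma norm_blockConv_le [DecidableEq J]
    (hc : ∀ i, ∑ j, (if blk j = i then c j else 0) ^ 2 ≤ 1 / p)
    (x : Fin n → ℝ) (β : ℝ) (hβ : 0 ≤ β)
    (h : ∀ j, |∑ t, rsign (σ (e j - t)) * x t| ≤ β) :
    ‖blockConv blk c e σ x‖ ≤ 2 / √p * β := by
  refine norm_matrixCLM_le _ (by positivity) fun u => ?_
  have hp : √(p : ℝ) ^ 2 = p := Real.sq_sqrt (by positivity)
  have hu : 0 ≤ ∑ s, u s ^ 2 := Finset.sum_nonneg fun _ _ => sq_nonneg _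
  calc _ = ∑ i, (∑ j, (if blk j = i then c j else 0) *
          ((if blk j = i then (1 : ℝ) else 0) * (circRows e σ x j * u j))) ^ 2 := by
        refine Finset.sum_congr rfl fun i _ => ?_
        congr 1
        refine Finset.sum_congr rfl fun j _ => ?_
        simp only [LinearMap.coe_mk, AddHom.coe_mk, Matrix.of_apply]
        split_ifs <;> ring
    _ ≤ ∑ i, (∑ j, (if blk j = i then c j else 0) ^ 2) *
          ∑ j, ((if blk j = i then (1 : ℝ) else 0) * (circRows e σ x j * u j)) ^ 2 :=
        Finset.sum_le_sum fun i _ => Finset.sum_mul_sq_le_sq_mul_sq _ _ _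
    _ ≤ ∑ i, 1 / (p : ℝ) *
          ∑ j, ((if blk j = i then (1 : ℝ) else 0) * (circRows e σ x j * u j)) ^ 2 :=
        Finset.sum_le_sum fun i _ => mul_le_mul_of_nonneg_right (hc i)
          (Finset.sum_nonneg fun _ _ => sq_nonneg _)
    _ = 1 / p * ∑ j, circRows e σ x j ^ 2 * u j ^ 2 := by
        rw [← Finset.mul_sum, Finset.sum_comm]
        simp [ite_pow, mul_pow]
    _ ≤ 1 / p * ∑ j, β ^ 2 * u j ^ 2 := by
        refine mul_le_mul_of_nonneg_left (Finset.sum_le_sum fun j _ => ?_) (by positivity)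
        refine mul_le_mul_of_nonneg_right ?_ (sq_nonneg _)
        exact sq_le_sq' (abs_le.1 (h j)).1 (abs_le.1 (h j)).2
    _ ≤ _ := by
        rw [← Finset.mul_sum, mul_pow, div_pow, hp, ← mul_assoc]
        refine mul_le_mul_of_nonneg_right ?_ hu
        rw [div_mul_eq_mul_div, div_mul_eq_mul_div]
        gcongr
        norm_num

variable [NeZero n]

lemma norm_sq_weightedConv_rad (x : Fin n → ℝ) :
    ‖weightedConv c e x (rad σ)‖ ^ 2 = ∑ j, c j ^ 2 * circRows e σ x j ^ 2 := by
  rw [norm_sq_weightedConv]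
  refine Finset.sum_congr rfl fun j _ => ?_
  rw [← mul_pow, circRows, Finset.mul_sum]
  congr 1
  refine Fintype.sum_equiv (Equiv.subLeft (e j)) _ _ fun s => ?_
  simp only [Equiv.subLeft_apply, sub_sub_cancel, rad]
  ring

lemma expect_norm_sq_weightedConv (x : Fin n → ℝ) :
    𝔼 ζ : Fin n → Bool, ‖weightedConv c e x (rad ζ)‖ ^ 2 =
      (∑ j, c j ^ 2) * ∑ t, x t ^ 2 := by
  refine (expect_norm_sq_matrixCLM _).trans ?_
  rw [Finset.sum_mul]
  refine Finset.sum_congr rfl fun j _ => ?_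
  simp only [LinearMap.coe_mk, AddHom.coe_mk, Matrix.of_apply, mul_pow]
  rw [← Finset.mul_sum]
  congr 1
  exact Fintype.sum_equiv (Equiv.subLeft (e j)) _ _ fun s => rfl

/-- Real and imaginary parts of the additive characters of `ℤ/nℤ`. -/
def charPart (i : AddChar (Fin n) ℂ × Bool) (t : Fin n) : ℝ :=
  if i.2 then (i.1 t).re else (i.1 t).im

lemma abs_charPart_le (i : AddChar (Fin n) ℂ × Bool) (t : Fin n) : |charPart i t| ≤ 1 := by
  have h := i.1.norm_apply t
  unfold charPart
  split_ifs
  · exact (Complex.abs_re_le_norm _).trans h.le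
  · exact (Complex.abs_im_le_norm _).trans h.le

lemma norm_transform_le {x : Fin n → ℝ} {β : ℝ} (h : ∀ i, |∑ t, charPart i t * x t| ≤ β)
    (ψ : AddChar (Fin n) ℂ) : ‖∑ t, (x t : ℂ) * ψ t‖ ≤ 2 * β := by
  refine (Complex.norm_le_abs_re_add_abs_im _).trans ?_
  have h1 := h (ψ, true)
  have h2 := h (ψ, false)
  simp only [charPart, if_true, Bool.false_eq_true, if_false] at h1 h2
  have e1 : (∑ t, (x t : ℂ) * ψ t).re = ∑ t, (ψ t).re * x t := by
    simp [Complex.re_sum, mul_comm]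
  have e2 : (∑ t, (x t : ℂ) * ψ t).im = ∑ t, (ψ t).im * x t := by
    simp [Complex.im_sum, mul_comm]
  rw [e1, e2]
  linarith

lemma norm_weightedConv_le (he : Function.Injective e) (hc : ∀ j, c j ^ 2 ≤ 1 / p)
    (x : Fin n → ℝ) (β : ℝ) (hβ : 0 ≤ β) (h : ∀ i, |∑ t, charPart i t * x t| ≤ β) :
    ‖weightedConv c e x‖ ≤ 2 / √p * β := by
  refine norm_matrixCLM_le _ (by positivity) fun u => ?_
  have hp : √(p : ℝ) ^ 2 = p := Real.sq_sqrt (by positivity)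
  calc _ = ∑ j, c j ^ 2 * (∑ s, x (e j - s) * u s) ^ 2 := by
        refine Finset.sum_congr rfl fun j _ => ?_
        simp only [LinearMap.coe_mk, AddHom.coe_mk, Matrix.of_apply]
        rw [← mul_pow, Finset.mul_sum]
        simp_rw [mul_assoc]
    _ ≤ ∑ j, 1 / p * (∑ s, x (e j - s) * u s) ^ 2 :=
        Finset.sum_le_sum fun j _ => mul_le_mul_of_nonneg_right (hc j) (sq_nonneg _)
    _ = 1 / p * ∑ j, (∑ s, x (e j - s) * u s) ^ 2 := by rw [Finset.mul_sum]
    _ ≤ 1 / p * ∑ a, (∑ s, x (a - s) * u s) ^ 2 := by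
        gcongr
        refine le_of_eq_of_le ?_ (Finset.sum_le_univ_sum_of_nonneg
          (s := Finset.univ.map ⟨e, he⟩) fun a => sq_nonneg _)
        rw [Finset.sum_map]
        rfl
    _ ≤ 1 / p * ((2 * β) ^ 2 * ∑ s, u s ^ 2) := by
        gcongr
        exact sum_sq_convolution_le x u (norm_transform_le h)
    _ = _ := by
        rw [mul_pow (2 / √(p : ℝ)), div_pow, hp]
        ring

variable [DecidableEq J]

lemma expect_norm_sq_blockConv (x : Fin n → ℝ) :
    𝔼 ζ : J → Bool, ‖blockConv blk c e σ x (rad ζ)‖ ^ 2 =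
      ‖weightedConv c e x (rad σ)‖ ^ 2 := by
  refine (expect_norm_sq_matrixCLM _).trans ?_
  rw [norm_sq_weightedConv_rad, Finset.sum_comm]
  refine Finset.sum_congr rfl fun j _ => ?_
  simp [mul_pow, ite_pow]

/-- Expected uniform deviation, with weights of total square `1 / p` on each of `p` blocks. -/
lemma expect_expect_iSup_blockConv_le (hn : 2 ≤ n) (hk : 0 < k) (hp : Fintype.card P = p)
    (hp0 : 0 < p) (he : Function.Injective e)
    (hc : ∀ i, ∑ j, (if blk j = i then c j else 0) ^ 2 = 1 / p)
    {K : ℝ} (hK : 40320 * Real.log n ^ 2 * (√k / √p) ≤ K) (hK' : K ≤ 1 / 8) :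
    𝔼 σ : Fin n → Bool, 𝔼 ξ : J → Bool,
      ⨆ x : TkR n k, |‖blockConv blk c e σ x (rad ξ)‖ ^ 2 - 1| ≤ 8 * K := by
  have := nonempty_TkR (n := n) (by omega) hk
  have hcj : ∀ j, c j ^ 2 ≤ 1 / p := fun j => by
    have := Finset.single_le_sum (f := fun l => (if blk l = blk j then c l else 0) ^ 2)
      (fun _ _ => sq_nonneg _) (Finset.mem_univ j)
    rw [hc] at this
    simpa using this
  have hsum : ∑ j, c j ^ 2 = 1 := by
    have h1 : ∑ i, ∑ j, (if blk j = i then c j else 0) ^ 2 = 1 := by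
      simp_rw [hc]
      simp [hp, hp0.ne']
    rw [Finset.sum_comm] at h1
    simpa [ite_pow] using h1
  have hJ : Fintype.card J ≤ n := by simpa using Fintype.card_le_of_injective e he
  have hτ : Fintype.card (AddChar (Fin n) ℂ × Bool) ≤ 2 * n := by
    simp [AddChar.card_eq, mul_comm]
  have hmean : ∀ x : TkR n k, 𝔼 ζ : Fin n → Bool, ‖weightedConv c e x (rad ζ)‖ ^ 2 = 1 :=
    fun x => by rw [expect_norm_sq_weightedConv, hsum, sum_sq_of_mem_TkR x.2, mul_one]
  have hW := norm_weightedConv_le he hcj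
  have hB := fun σ : Fin n → Bool =>
    norm_blockConv_le (e := e) (σ := σ) fun i => (hc i).le
  have hf : ∀ (σ : Fin n → Bool) (j : J) (t : Fin n), |rsign (σ (e j - t))| ≤ 1 :=
    fun σ j t => (abs_rsign _).le
  have hJ2 : Fintype.card J ≤ 2 * n := by omega
  set D : (Fin n → Bool) → ℝ := fun σ =>
    ⨆ x : TkR n k, |‖weightedConv c e x (rad σ)‖ ^ 2 - 1| with hD
  have hX : 𝔼 σ, D σ ≤ K * (1 + 1) := by
    have := expect_chaos_TkR_le_mul (k := k) hn hk hp0 (by simp) hτ abs_charPart_le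
      (weightedConv c e) hW hK hK' fun x => (hmean x).le
    simpa only [hmean] using this
  have hDx : ∀ σ, ∀ x : TkR n k, |‖weightedConv c e x (rad σ)‖ ^ 2 - 1| ≤ D σ := by
    intro σ x
    have := bddAbove_chaos_TkR (k := k) hn hk hp0 hτ abs_charPart_le (weightedConv c e) hW σ
    simp only [hmean] at this
    exact le_ciSup this x
  have hE : ∀ σ, 𝔼 ξ : J → Bool,
      ⨆ x : TkR n k, |‖blockConv blk c e σ x (rad ξ)‖ ^ 2 - 1| ≤ K * (2 + D σ) + D σ := by
    intro σ
    have h1 := expect_chaos_TkR_le_mul (k := k) hn hk hp0 hJ hJ2 (hf σ)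
      (blockConv blk c e σ) (hB σ) hK hK' (Q := 1 + D σ) fun x => by
        rw [expect_norm_sq_blockConv]
        linarith [(abs_le.1 (hDx σ x)).2]
    have h2 : ∀ ξ : J → Bool, ⨆ x : TkR n k, |‖blockConv blk c e σ x (rad ξ)‖ ^ 2 - 1| ≤
        (⨆ x : TkR n k, |‖blockConv blk c e σ x (rad ξ)‖ ^ 2 -
          𝔼 ζ : J → Bool, ‖blockConv blk c e σ x (rad ζ)‖ ^ 2|) + D σ := by
      intro ξ
      refine ciSup_le fun x => ?_
      have h3 := le_ciSup (bddAbove_chaos_TkR (k := k) hn hk hp0 hJ2 (hf σ)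
        (blockConv blk c e σ) (hB σ) ξ) x
      refine le_trans ?_ (add_le_add h3 (hDx σ x))
      rw [expect_norm_sq_blockConv]
      exact abs_sub_le _ _ _
    refine (Finset.expect_le_expect fun ξ _ => h2 ξ).trans ?_
    rw [Finset.expect_add_distrib, Fintype.expect_const]
    linarith
  refine (Finset.expect_le_expect fun σ _ => hE σ).trans ?_
  rw [Finset.expect_add_distrib, ← Finset.mul_expect, Finset.expect_add_distrib,
    Fintype.expect_const]
  have hK0 : 0 ≤ K := le_trans (by positivity) hK
  nlinarith

end Circulant

/-! ### The block-diagonal matrix `I_p ⊗ v` -/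

section Kron

variable {p lam : ℕ}

lemma norm2_pos {v : Fin lam → ℝ} (hv : v ≠ 0) : 0 < norm2 v := by
  obtain ⟨j, hj⟩ := Function.ne_iff.1 hv
  refine Real.sqrt_pos.2 (Finset.sum_pos' (fun _ _ => sq_nonneg _) ⟨j, Finset.mem_univ _, ?_⟩)
  exact sq_pos_of_ne_zero hj

/-- The entry of the normalized matrix `I_p ⊗ v` in column `j`, on the diagonal block. -/
def kronWeight (p : ℕ) {lam : ℕ} (v : Fin lam → ℝ) (j : Fin (p * lam)) : ℝ :=
  1 / (norm2 v * √p) * v j.modNat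

lemma smul_kronRow_apply (v : Fin lam → ℝ) (i : Fin p) (j : Fin (p * lam)) :
    ((1 / (norm2 v * √p)) • kronRow p v) i j =
      if j.divNat = i then kronWeight p v j else 0 := by
  have hlam : 0 < lam := Nat.pos_of_ne_zero fun h => by
    subst h
    exact absurd j.2 (by simp)
  have h : ((j : ℕ) / lam = i) ↔ j.divNat = i := by rw [Fin.ext_iff, Fin.coe_divNat]
  simp only [Matrix.smul_apply, kronRow, Matrix.of_apply, smul_eq_mul, h, Nat.mod_lt _ hlam,
    dite_true, mul_ite, mul_zero]
  rfl

lemma sum_sq_kronWeight (hp : 0 < p) {v : Fin lam → ℝ} (hv : v ≠ 0) (i : Fin p) :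
    ∑ j : Fin (p * lam), (if j.divNat = i then kronWeight p v j else 0) ^ 2 = 1 / p := by
  have hv' := norm2_pos hv
  rw [← finProdFinEquiv.sum_comp, Fintype.sum_prod_type]
  have h : ∀ (a : Fin p) (b : Fin lam), (finProdFinEquiv (a, b)).divNat = a ∧
      (finProdFinEquiv (a, b)).modNat = b := fun a b =>
    Prod.ext_iff.1 (finProdFinEquiv.symm_apply_apply (a, b))
  simp only [h, kronWeight]
  rw [Finset.sum_eq_single i (fun a _ ha => by simp [ha]) (by simp)]
  simp only [if_true, mul_pow, ← Finset.mul_sum]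
  rw [← norm2_sq, div_pow, mul_pow, Real.sq_sqrt (by positivity)]
  field_simp

end Kron

lemma norm2_sq_mulVec_eq {n p lam : ℕ} (v : Fin lam → ℝ)
    (e : Fin (p * lam) → Fin n) (σ : Fin n → Bool) (ξ : Fin (p * lam) → Bool) (x : Fin n → ℝ) :
    norm2 ((((1 / (norm2 v * Real.sqrt p)) • kronRow p v) *
        Matrix.of fun j t =>
          rsign (ξ j) * Matrix.circulant (fun s => rsign (σ s)) (e j) t).mulVec x) ^ 2 =
      ‖blockConv Fin.divNat (kronWeight p v) e σ x (rad ξ)‖ ^ 2 := by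
  rw [norm2_sq, norm_sq_blockConv, ← Matrix.mulVec_mulVec]
  refine Finset.sum_congr rfl fun i _ => ?_
  rw [Matrix.mulVec, dotProduct]
  congr 1
  refine Finset.sum_congr rfl fun j _ => ?_
  rw [smul_kronRow_apply, mul_assoc]
  congr 1
  simp only [Matrix.mulVec, dotProduct, Matrix.of_apply, Matrix.circulant_apply, circRows, rad,
    Finset.sum_mul]
  exact Finset.sum_congr rfl fun t _ => by ring

/-- The sample-size condition in the form used for the chaos bounds. -/
lemma log_sq_mul_sqrt_div_sqrt_le {n k p : ℕ} {α : ℝ} (hp : 0 < p) (hα : 0 < α)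
    (h : 10 ^ 12 * (k : ℝ) * Real.log n ^ 4 / α ^ 2 ≤ p) :
    40320 * Real.log n ^ 2 * (√k / √p) ≤ α / 8 := by
  have hp' : (0 : ℝ) < √p := Real.sqrt_pos.2 (by exact_mod_cast hp)
  rw [div_le_iff₀ (by positivity)] at h
  rw [← mul_div_assoc, div_le_iff₀ hp']
  refine le_of_sq_le_sq ?_ (by positivity)
  have h1 : √(k : ℝ) ^ 2 = k := Real.sq_sqrt (by positivity)
  have h2 : √(p : ℝ) ^ 2 = p := Real.sq_sqrt (by positivity)
  have h3 : 0 ≤ (k : ℝ) * Real.log n ^ 4 := by positivity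
  calc _ = 40320 ^ 2 * (k * Real.log n ^ 4) := by rw [mul_pow, h1]; ring
    _ ≤ 1 / 64 * (p * α ^ 2) := by linarith
    _ = _ := by rw [mul_pow, h2]; ring

/-- expected restricted isometry bound
`E sup_{x ∈ T_k} | ‖V̂Φx‖₂² − ‖x‖₂² | ≤ α` for `V̂ = (1/(‖v‖₂√p))(I_p ⊗ v)` and `Φ` from
the sign-randomized partial circulant ensemble, provided `m ≥ p ≥ C₁ k log⁴(n)/α²`.
The set `Ω ⊂ {1,…,n}` of retained rows, `|Ω| = m`, is encoded by the injection `e`;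
the expectation is the uniform average over the Rademacher vectors `σ` and `ε`. -/
theorem stmt13 :
    ∃ C₁ : ℝ, 0 < C₁ ∧
      ∀ (n k p lam : ℕ) (α : ℝ) (v : Fin lam → ℝ) (e : Fin (p * lam) → Fin n),
        2 ≤ n → 0 < k → k ≤ n → 0 < p → 0 < lam →
        0 < α → α < 1 →
        Function.Injective e →
        v ≠ 0 →
        p ≤ p * lam →
        C₁ * (k : ℝ) * (Real.log n) ^ 4 / α ^ 2 ≤ (p : ℝ) →
        (∑ ω : (Fin n → Bool) × (Fin (p * lam) → Bool),
            sSup {c : ℝ | ∃ x ∈ TkR n k,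
              c = |(norm2 ((((1 / (norm2 v * Real.sqrt p)) • kronRow p v) *
                      Matrix.of fun j t =>
                        rsign (ω.2 j) * Matrix.circulant (fun s => rsign (ω.1 s)) (e j) t).mulVec
                        x)) ^ 2
                    - (norm2 x) ^ 2|})
          / (Fintype.card ((Fin n → Bool) × (Fin (p * lam) → Bool)) : ℝ) ≤ α := by
  refine ⟨10 ^ 12, by norm_num, ?_⟩
  intro n k p lam α v e hn hk _ hp _ hα hα1 he hv _ hC
  have : NeZero n := ⟨by omega⟩
  have hK := log_sq_mul_sqrt_div_sqrt_le hp hα hC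
  have h := expect_expect_iSup_blockConv_le (k := k) hn hk (Fintype.card_fin p) hp he
    (sum_sq_kronWeight hp hv) hK (by linarith)
  rw [← Fintype.expect_eq_sum_div_card, ← Finset.univ_product_univ, Finset.expect_product]
  refine le_of_eq_of_le ?_ (h.trans (by linarith))
  refine Finset.expect_congr rfl fun σ _ => Finset.expect_congr rfl fun ξ _ => ?_
  rw [iSup]
  congr 1
  ext c
  constructor
  · rintro ⟨x, hx, rfl⟩
    exact ⟨⟨x, hx⟩, by simp only [norm2_sq_mulVec_eq, hx.1, one_pow]⟩
  · rintro ⟨x, rfl⟩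
    exact ⟨x, x.2, by simp only [norm2_sq_mulVec_eq, x.2.1, one_pow]⟩
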